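/- arXiv:2401.01695 — 4 statements merged into one kernel-verified Lean document; each statement's English description precedes it below -/
import Mathlib

section
/- Let X and Y be normed spaces and let ω be an admissible modulus. Then VC^{0,ω}(X,Y) equals the closure, in the Ċ^{0,ω}(X,Y) seminorm, of the set of functions in VC^{0,ω}_small(X,Y) that are continuous and have bounded support. -/
open Filter Set

/-- An admissible modulus of continuity `ω : (0,∞) → (0,∞)`: positive, non-decreasing,
`ω(t) → 0` as `t → 0⁺`, `ω(t) → ∞` as `t → ∞`, `t/ω(t) → 0` as `t → 0⁺`, and doubling. -/
def Admissible (ω : ℝ → ℝ) : Prop :=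
  (∀ t : ℝ, 0 < t → 0 < ω t) ∧
  (∀ s t : ℝ, 0 < s → s ≤ t → ω s ≤ ω t) ∧
  Tendsto ω (nhdsWithin 0 (Ioi 0)) (nhds 0) ∧
  Tendsto ω atTop atTop ∧
  Tendsto (fun t => t / ω t) (nhdsWithin 0 (Ioi 0)) (nhds 0) ∧
  ∃ C : ℝ, 1 < C ∧ ∀ t : ℝ, 0 < t → ω (2 * t) ≤ C * ω t

section Defs

variable {X Y : Type*} [NormedAddCommGroup X] [NormedSpace ℝ X]
  [NormedAddCommGroup Y] [NormedSpace ℝ Y]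

/-- `‖f‖_{Ċ^{0,ω}} ≤ M`. -/
def HolderLE (ω : ℝ → ℝ) (f : X → Y) (M : ℝ) : Prop :=
  ∀ x y : X, x ≠ y → ‖f x - f y‖ ≤ M * ω ‖x - y‖

/-- `f ∈ Ċ^{0,ω}(X,Y)`: the homogeneous Hölder seminorm is finite. -/
def HolderFinite (ω : ℝ → ℝ) (f : X → Y) : Prop :=
  ∃ M : ℝ, HolderLE ω f M

/-- `f ∈ VC^{0,ω}_small(X,Y)`. -/
def VCsmall (ω : ℝ → ℝ) (f : X → Y) : Prop :=
  HolderFinite ω f ∧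
    ∀ ε : ℝ, 0 < ε → ∃ δ : ℝ, 0 < δ ∧ ∀ x y : X, x ≠ y → ‖x - y‖ < δ →
      ‖f x - f y‖ ≤ ε * ω ‖x - y‖

/-- `f ∈ VC^{0,ω}_large(X,Y)`. -/
def VClarge (ω : ℝ → ℝ) (f : X → Y) : Prop :=
  HolderFinite ω f ∧
    ∀ ε : ℝ, 0 < ε → ∃ δ : ℝ, 0 < δ ∧ ∀ x y : X, δ < ‖x - y‖ →
      ‖f x - f y‖ ≤ ε * ω ‖x - y‖

/-- `f ∈ VC^{0,ω}_far(X,Y)`. -/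
def VCfar (ω : ℝ → ℝ) (f : X → Y) : Prop :=
  HolderFinite ω f ∧
    ∀ ε : ℝ, 0 < ε → ∃ δ : ℝ, 0 < δ ∧ ∀ x y : X, x ≠ y → δ < ‖x‖ → δ < ‖y‖ →
      ‖f x - f y‖ ≤ ε * ω ‖x - y‖

/-- `f ∈ VC^{0,ω}(X,Y)`, the intersection of the three vanishing classes. -/
def VCfull (ω : ℝ → ℝ) (f : X → Y) : Prop :=
  VCsmall ω f ∧ VClarge ω f ∧ VCfar ω f

/-- `f` has bounded support: it vanishes outside some bounded set. -/
def BddSupp (f : X → Y) : Prop :=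
  ∃ R : ℝ, ∀ x : X, R < ‖x‖ → f x = 0

end Defs

section Holder

variable {X Y : Type*} [NormedAddCommGroup X] [NormedAddCommGroup Y]

lemma HolderFinite.exists_nonneg {ω : ℝ → ℝ} (hω : Admissible ω) {f : X → Y}
    (hf : HolderFinite ω f) : ∃ M : ℝ, 0 ≤ M ∧ HolderLE ω f M := by
  obtain ⟨M, hM⟩ := hf
  refine ⟨max M 0, le_max_right _ _, fun x y hxy => (hM x y hxy).trans ?_⟩
  exact mul_le_mul_of_nonneg_right (le_max_left _ _)
    (hω.1 _ (norm_pos_iff.2 (sub_ne_zero.2 hxy))).le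

lemma HolderLE.norm_sub_zero_le {ω : ℝ → ℝ} (hω : Admissible ω) {f : X → Y} {M : ℝ}
    (hM : 0 ≤ M) (hf : HolderLE ω f M) {R : ℝ} (hR : 0 < R) {x : X} (hx : ‖x‖ ≤ R) :
    ‖f x - f 0‖ ≤ M * ω R := by
  by_cases h : x = 0
  · simpa [h] using mul_nonneg hM (hω.1 R hR).le
  · refine (hf x 0 h).trans (mul_le_mul_of_nonneg_left ?_ hM)
    rw [sub_zero]
    exact hω.2.1 _ _ (norm_pos_iff.2 h) hx

lemma HolderFinite.continuous {ω : ℝ → ℝ} (hω : Admissible ω) {f : X → Y}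
    (hf : HolderFinite ω f) : Continuous f := by
  obtain ⟨M, hM0, hM⟩ := hf.exists_nonneg hω
  rw [Metric.continuous_iff]
  intro x ε hε
  obtain ⟨δ, hδ, h⟩ := Metric.tendsto_nhdsWithin_nhds.1 hω.2.2.1 (ε / (M + 1)) (by positivity)
  refine ⟨δ, hδ, fun y hy => ?_⟩
  by_cases hxy : y = x
  · simpa [hxy] using hε
  have hpos : 0 < ‖y - x‖ := norm_pos_iff.2 (sub_ne_zero.2 hxy)
  rw [dist_eq_norm] at hy ⊢
  have h1 : ω ‖y - x‖ < ε / (M + 1) := by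
    have := h (x := ‖y - x‖) hpos (by simpa using hy)
    rw [Real.dist_eq, sub_zero] at this
    exact (le_abs_self _).trans_lt this
  have h2 := hω.1 _ hpos
  rw [lt_div_iff₀ (by positivity)] at h1
  have := hM y x hxy
  linarith

end Holder

lemma Admissible.exists_forall_div_le {ω : ℝ → ℝ} (hω : Admissible ω) {ε : ℝ} (hε : 0 < ε) :
    ∃ δ : ℝ, 0 < δ ∧ ∀ t, 0 < t → t < δ → t ≤ ε * ω t := by
  obtain ⟨δ, hδ, h⟩ := Metric.tendsto_nhdsWithin_nhds.1 hω.2.2.2.2.1 ε hε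
  refine ⟨δ, hδ, fun t ht htδ => ?_⟩
  have := h (x := t) ht (by simpa [abs_of_pos ht] using htδ)
  rw [Real.dist_eq, sub_zero] at this
  exact ((div_lt_iff₀ (hω.1 t ht)).1 ((le_abs_self _).trans_lt this)).le

lemma Admissible.exists_forall_mul_le {ω : ℝ → ℝ} (hω : Admissible ω) {K : ℝ} (hK : 0 ≤ K) :
    ∃ R₀ : ℝ, ∀ R t, R₀ ≤ R → 0 < t → t ≤ R → K * t ≤ R * ω t := by
  obtain ⟨δ, hδ, h⟩ := hω.exists_forall_div_le one_pos
  obtain ⟨S, hS⟩ := eventually_atTop.1 (hω.2.2.2.1.eventually_ge_atTop K)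
  refine ⟨max K (K * S / ω δ), fun R t hR ht htR => ?_⟩
  have hωt := hω.1 t ht
  have hωδ := hω.1 δ hδ
  obtain ⟨hR1, hR2⟩ := max_le_iff.1 hR
  rcases lt_or_ge t δ with htδ | htδ
  · have := h t ht htδ
    nlinarith
  rcases le_total S t with hSt | hSt
  · have := hS t hSt
    nlinarith
  · rw [div_le_iff₀ hωδ] at hR2
    have h1 := hω.2.1 δ t hδ htδ
    calc K * t ≤ K * S := by gcongr
      _ ≤ R * ω δ := hR2
      _ ≤ R * ω t := by gcongr; linarith

section Cutoff

variable {X : Type*} [NormedAddCommGroup X]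

/-- The radial cutoff equal to `1` on the ball of radius `R` and to `0` outside the ball of
radius `2 * R`, and affine in the norm in between. -/
noncomputable def radialCutoff (R : ℝ) (x : X) : ℝ := max 0 (min 1 (2 - ‖x‖ / R))

lemma radialCutoff_nonneg (R : ℝ) (x : X) : 0 ≤ radialCutoff R x := le_max_left _ _

lemma radialCutoff_le_one (R : ℝ) (x : X) : radialCutoff R x ≤ 1 :=
  max_le zero_le_one (min_le_left _ _)

lemma radialCutoff_eq_one {R : ℝ} (hR : 0 < R) {x : X} (hx : ‖x‖ ≤ R) :
    radialCutoff R x = 1 := by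
  have : ‖x‖ / R ≤ 1 := (div_le_one hR).2 hx
  rw [radialCutoff, min_eq_left (by linarith), max_eq_right zero_le_one]

lemma radialCutoff_eq_zero {R : ℝ} (hR : 0 < R) {x : X} (hx : 2 * R ≤ ‖x‖) :
    radialCutoff R x = 0 := by
  have : 2 ≤ ‖x‖ / R := (le_div_iff₀ hR).2 hx
  exact max_eq_left ((min_le_right _ _).trans (by linarith))

lemma abs_radialCutoff_sub_le_one (R : ℝ) (x y : X) :
    |radialCutoff R x - radialCutoff R y| ≤ 1 := by
  have := radialCutoff_nonneg R x
  have := radialCutoff_nonneg R y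
  have := radialCutoff_le_one R x
  have := radialCutoff_le_one R y
  rw [abs_le]
  constructor <;> linarith

lemma abs_radialCutoff_sub_le {R : ℝ} (hR : 0 < R) (x y : X) :
    |radialCutoff R x - radialCutoff R y| ≤ ‖x - y‖ / R := by
  have h1 : |(2 - ‖x‖ / R) - (2 - ‖y‖ / R)| ≤ ‖x - y‖ / R := by
    have : (2 - ‖x‖ / R) - (2 - ‖y‖ / R) = (‖y‖ - ‖x‖) / R := by ring
    rw [this, abs_div, abs_of_pos hR, norm_sub_rev]
    gcongr
    exact abs_norm_sub_norm_le y x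
  refine le_trans ?_ h1
  refine (abs_max_sub_max_le_max _ _ _ _).trans (max_le (by simp) ?_)
  exact (abs_min_sub_min_le_max _ _ _ _).trans (max_le (by simp) le_rfl)

end Cutoff

section Chain

variable {X Y : Type*} [NormedAddCommGroup X] [NormedSpace ℝ X] [NormedAddCommGroup Y]

/-- Chaining along the segment joining two points of a common ray that avoids a ball. -/
lemma norm_sub_le_of_chain {ω : ℝ → ℝ} (hω : Admissible ω) {f : X → Y} {ε δ : ℝ}
    (hε : 0 ≤ ε) (hδ : 0 ≤ δ)
    (hf : ∀ x y : X, x ≠ y → δ < ‖x‖ → δ < ‖y‖ → ‖f x - f y‖ ≤ ε * ω ‖x - y‖)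
    {u : X} (hu : ‖u‖ = 1) {a t : ℝ} (ha : δ < a) {s : ℝ} (hs : 0 < s)
    (hst : s ≤ t) (n : ℕ) :
    ‖f ((a + n * s) • u) - f (a • u)‖ ≤ n * (ε * ω t) := by
  induction n with
  | zero => simp
  | succ n ih =>
    have hn : (0 : ℝ) ≤ n * s := by positivity
    have hnorm : ∀ c : ℝ, δ < c → δ < ‖c • u‖ := fun c hc => by
      rwa [norm_smul, hu, mul_one, Real.norm_of_nonneg (by linarith)]
    have hd : (a + (n + 1 : ℕ) * s) • u - (a + n * s) • u = s • u := by
      push_cast; module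
    have hdn : ‖(a + (n + 1 : ℕ) * s) • u - (a + n * s) • u‖ = s := by
      rw [hd, norm_smul, hu, mul_one, Real.norm_of_nonneg hs.le]
    have h1 := hf ((a + (n + 1 : ℕ) * s) • u) ((a + n * s) • u)
      (fun h => by rw [h, sub_self, norm_zero] at hdn; linarith)
      (hnorm _ (by push_cast; nlinarith)) (hnorm _ (by linarith))
    rw [hdn] at h1
    have h2 : ε * ω s ≤ ε * ω t := mul_le_mul_of_nonneg_left (hω.2.1 s t hs hst) hε
    have h3 := norm_sub_le_norm_sub_add_norm_sub (f ((a + (n + 1 : ℕ) * s) • u))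
      (f ((a + n * s) • u)) (f (a • u))
    push_cast at *
    linarith

/-- A function vanishing at infinity in the Hölder sense grows slowly on large balls, relative
to the largest slope that the modulus allows at any smaller scale. -/
lemma VCfar.exists_growth_le {ω : ℝ → ℝ} (hω : Admissible ω) {f : X → Y}
    (hf : VCfar ω f) {ε : ℝ} (hε : 0 < ε) :
    ∃ R₀ : ℝ, ∀ R t, R₀ ≤ R → 0 < t → t ≤ R → ∀ y : X, ‖y‖ ≤ 2 * R →
      ‖f y - f 0‖ * t ≤ ε * (R * ω t) := by
  obtain ⟨M, hM0, hM⟩ := hf.1.exists_nonneg hω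
  obtain ⟨δ, hδ, hfar⟩ := hf.2 (ε / 4) (by positivity)
  have hδ1 : 0 < δ + 1 := by linarith
  set K := M * ω (δ + 1) with hKdef
  have hK : 0 ≤ K := mul_nonneg hM0 (hω.1 _ hδ1).le
  obtain ⟨R₀, hR₀⟩ := hω.exists_forall_mul_le (K := K / (ε / 4)) (by positivity)
  refine ⟨R₀, fun R t hR ht htR y hy => ?_⟩
  have hωt := hω.1 t ht
  have hRpos : 0 < R := ht.trans_le htR
  have hKt : K * t ≤ ε / 4 * (R * ω t) := by
    have := hR₀ R t hR ht htR
    rw [div_mul_eq_mul_div, div_le_iff₀ (by positivity)] at this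
    linarith
  have hrest : 0 ≤ ε * (R * ω t) := by positivity
  rcases le_or_gt ‖y‖ (δ + 1) with hyδ | hyδ
  · have := hM.norm_sub_zero_le hω hM0 hδ1 hyδ
    nlinarith
  have hy0 : 0 < ‖y‖ := hδ1.trans hyδ
  set u : X := ‖y‖⁻¹ • y with hudef
  have hu : ‖u‖ = 1 := by
    rw [hudef, norm_smul, norm_inv, norm_norm, inv_mul_cancel₀ hy0.ne']
  set n := ⌈2 * R / t⌉₊ with hndef
  have hn1 : 2 * R / t ≤ n := Nat.le_ceil _
  have hn2 : (n : ℝ) < 2 * R / t + 1 := Nat.ceil_lt_add_one (by positivity)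
  have hnpos : (0 : ℝ) < n := lt_of_lt_of_le (by positivity) hn1
  have hns : (n : ℝ) * ((‖y‖ - (δ + 1)) / n) = ‖y‖ - (δ + 1) := by field_simp
  have hs : (‖y‖ - (δ + 1)) / n ≤ t := by
    rw [div_le_iff₀ hnpos]
    rw [div_le_iff₀ ht] at hn1
    linarith
  have hchain := norm_sub_le_of_chain hω (by positivity) hδ.le hfar hu
    (a := δ + 1) (by linarith) (div_pos (sub_pos.2 hyδ) hnpos) hs n
  have hyu : (δ + 1 + (n : ℝ) * ((‖y‖ - (δ + 1)) / n)) • u = y := by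
    rw [hns, add_sub_cancel, hudef, smul_smul, mul_inv_cancel₀ hy0.ne', one_smul]
  rw [hyu] at hchain
  have hbase := hM.norm_sub_zero_le hω hM0 hδ1 (x := (δ + 1) • u)
    (by rw [norm_smul, hu, mul_one, Real.norm_of_nonneg hδ1.le])
  have htri := norm_sub_le_norm_sub_add_norm_sub (f y) (f ((δ + 1) • u)) (f 0)
  have hnt : (n : ℝ) * t ≤ 3 * R := by
    have : (n : ℝ) * t ≤ (2 * R / t + 1) * t := by gcongr
    have h2 : (2 * R / t + 1) * t = 2 * R + t := by field_simp
    linarith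
  calc ‖f y - f 0‖ * t ≤ (n * (ε / 4 * ω t) + K) * t := by gcongr; linarith
    _ = n * t * (ε / 4 * ω t) + K * t := by ring
    _ ≤ 3 * R * (ε / 4 * ω t) + ε / 4 * (R * ω t) := by gcongr
    _ = ε * (R * ω t) := by ring

end Chain

section Truncation

variable {X Y : Type*} [NormedAddCommGroup X] [NormedAddCommGroup Y]

lemma HolderLE.of_norm_le {ω : ℝ → ℝ} {f : X → Y} {M : ℝ}
    (h : ∀ x y : X, x ≠ y → ‖y‖ ≤ ‖x‖ → ‖f x - f y‖ ≤ M * ω ‖x - y‖) : HolderLE ω f M := by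
  intro x y hxy
  rcases le_total ‖y‖ ‖x‖ with hle | hle
  · exact h x y hxy hle
  · rw [norm_sub_rev, norm_sub_rev x y]
    exact h y x hxy.symm hle

variable [NormedSpace ℝ Y]

/-- The truncation of `f - f 0` to the ball of radius `2 * R`. -/
noncomputable def truncation (R : ℝ) (f : X → Y) (x : X) : Y := radialCutoff R x • (f x - f 0)

lemma bddSupp_truncation {R : ℝ} (hR : 0 < R) (f : X → Y) : BddSupp (truncation R f) :=
  ⟨2 * R, fun x hx => by rw [truncation, radialCutoff_eq_zero hR hx.le, zero_smul]⟩

lemma VCsmall.truncation {ω : ℝ → ℝ} (hω : Admissible ω) {f : X → Y} (hf : VCsmall ω f)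
    {R : ℝ} (hR : 0 < R) (hfin : HolderFinite ω (truncation R f)) :
    VCsmall ω (truncation R f) := by
  refine ⟨hfin, fun ε hε => ?_⟩
  obtain ⟨M, hM0, hM⟩ := hf.1.exists_nonneg hω
  obtain ⟨δ₁, hδ₁, h₁⟩ := hf.2 (ε / 2) (by positivity)
  set B := M * ω (2 * R) with hB
  have hB0 : 0 ≤ B := mul_nonneg hM0 (hω.1 _ (by positivity)).le
  obtain ⟨δ₂, hδ₂, h₂⟩ := hω.exists_forall_div_le (ε := ε / 2 * R / (B + 1)) (by positivity)
  refine ⟨min δ₁ δ₂, lt_min hδ₁ hδ₂, fun x y hxy hd => ?_⟩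
  wlog hle : ‖y‖ ≤ ‖x‖ generalizing x y
  · rw [norm_sub_rev, norm_sub_rev x y]
    exact this y x hxy.symm (by rwa [norm_sub_rev]) (le_of_not_ge hle)
  have hpos : 0 < ‖x - y‖ := norm_pos_iff.2 (sub_ne_zero.2 hxy)
  have hωt := hω.1 _ hpos
  rcases le_or_gt ‖y‖ (2 * R) with hy | hy
  · have hid : _root_.truncation R f x - _root_.truncation R f y
        = radialCutoff R x • (f x - f y)
          + (radialCutoff R x - radialCutoff R y) • (f y - f 0) := by
      simp only [_root_.truncation]; module
    have e1 : ‖radialCutoff R x • (f x - f y)‖ ≤ ε / 2 * ω ‖x - y‖ := by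
      rw [norm_smul, Real.norm_of_nonneg (radialCutoff_nonneg R x)]
      exact (mul_le_of_le_one_left (norm_nonneg _) (radialCutoff_le_one R x)).trans
        (h₁ x y hxy (hd.trans_le (min_le_left _ _)))
    have e2 : ‖(radialCutoff R x - radialCutoff R y) • (f y - f 0)‖ ≤ ε / 2 * ω ‖x - y‖ := by
      rw [norm_smul, Real.norm_eq_abs]
      have h3 := h₂ _ hpos (hd.trans_le (min_le_right _ _))
      calc _ ≤ ‖x - y‖ / R * (B + 1) := by
            gcongr
            · exact abs_radialCutoff_sub_le hR x y
            · exact (hM.norm_sub_zero_le hω hM0 (by positivity) hy).trans (by linarith)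
        _ ≤ (ε / 2 * R / (B + 1) * ω ‖x - y‖) / R * (B + 1) := by gcongr
        _ = ε / 2 * ω ‖x - y‖ := by field_simp
    rw [hid]
    have := norm_add_le (radialCutoff R x • (f x - f y))
      ((radialCutoff R x - radialCutoff R y) • (f y - f 0))
    linarith
  · rw [_root_.truncation, _root_.truncation, radialCutoff_eq_zero hR hy.le,
      radialCutoff_eq_zero hR (hy.le.trans hle), zero_smul, zero_smul, sub_zero, norm_zero]
    positivity

lemma exists_truncation_holderLE [NormedSpace ℝ X] {ω : ℝ → ℝ} (hω : Admissible ω) {f : X → Y}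
    (hlarge : VClarge ω f) (hfar : VCfar ω f) {ε : ℝ} (hε : 0 < ε) :
    ∃ R : ℝ, 0 < R ∧ HolderLE ω (fun x => f x - truncation R f x) ε := by
  obtain ⟨C, hC, hdb⟩ := hω.2.2.2.2.2
  obtain ⟨δ₁, hδ₁, h₁⟩ := hlarge.2 (ε / C) (by positivity)
  obtain ⟨δ₂, hδ₂, h₂⟩ := hfar.2 (ε / 2) (by positivity)
  obtain ⟨R₀, hR₀⟩ := hfar.exists_growth_le hω (ε := ε / 2) (by positivity)
  set R := max R₀ (max δ₁ (2 * δ₂)) with hRdef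
  have hR1 : R₀ ≤ R := le_max_left _ _
  have hR2 : δ₁ ≤ R := (le_max_left _ _).trans (le_max_right _ _)
  have hR3 : 2 * δ₂ ≤ R := (le_max_right _ _).trans (le_max_right _ _)
  have hR : 0 < R := hδ₁.trans_le hR2
  refine ⟨R, hR, HolderLE.of_norm_le fun x y hxy hle => ?_⟩
  have hpos : 0 < ‖x - y‖ := norm_pos_iff.2 (sub_ne_zero.2 hxy)
  have hωt := hω.1 _ hpos
  have hεω : 0 ≤ ε * ω ‖x - y‖ := by positivity
  rcases le_or_gt ‖x‖ R with hx | hx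
  · simpa [truncation, radialCutoff_eq_one hR hx, radialCutoff_eq_one hR (hle.trans hx)]
      using hεω
  have hx0 := radialCutoff_nonneg R x
  have hx1 := radialCutoff_le_one R x
  have hcoef : ‖1 - radialCutoff R x‖ ≤ 1 := by
    rw [Real.norm_eq_abs, abs_le]
    constructor <;> linarith
  rcases le_or_gt ‖y‖ δ₂ with hy | hy
  · have hid : f x - truncation R f x - (f y - truncation R f y)
        = (1 - radialCutoff R x) • (f x - f 0) := by
      rw [truncation, truncation, radialCutoff_eq_one hR (x := y) (by linarith)]
      module
    have htri : ‖x‖ - ‖y‖ ≤ ‖x - y‖ := norm_sub_norm_le x y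
    rw [hid, norm_smul]
    calc _ ≤ ‖f x - f 0‖ := mul_le_of_le_one_left (norm_nonneg _) hcoef
      _ ≤ ε / C * ω ‖x‖ := by simpa using h₁ x 0 (by simpa using hR2.trans_lt hx)
      _ ≤ ε / C * ω (2 * ‖x - y‖) := by
          gcongr
          exact hω.2.1 _ _ (hR.trans hx) (by linarith)
      _ ≤ ε / C * (C * ω ‖x - y‖) := by gcongr; exact hdb _ hpos
      _ = ε * ω ‖x - y‖ := by field_simp
  have hid : f x - truncation R f x - (f y - truncation R f y)
      = (1 - radialCutoff R x) • (f x - f y)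
        - (radialCutoff R x - radialCutoff R y) • (f y - f 0) := by
    simp only [truncation]; module
  have e1 : ‖(1 - radialCutoff R x) • (f x - f y)‖ ≤ ε / 2 * ω ‖x - y‖ := by
    rw [norm_smul]
    exact (mul_le_of_le_one_left (norm_nonneg _) hcoef).trans
      (h₂ x y hxy (hy.trans_le hle) hy)
  have e2 : ‖(radialCutoff R x - radialCutoff R y) • (f y - f 0)‖ ≤ ε / 2 * ω ‖x - y‖ := by
    rw [norm_smul, Real.norm_eq_abs]
    rcases le_or_gt ‖y‖ (2 * R) with hyR | hyR
    · rcases le_total ‖x - y‖ R with ht | ht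
      · have h3 := hR₀ R _ hR1 hpos ht y hyR
        calc _ ≤ ‖x - y‖ / R * ‖f y - f 0‖ := by
              gcongr; exact abs_radialCutoff_sub_le hR x y
          _ = ‖f y - f 0‖ * ‖x - y‖ / R := by ring
          _ ≤ ε / 2 * (R * ω ‖x - y‖) / R := by gcongr
          _ = ε / 2 * ω ‖x - y‖ := by field_simp
      · have h3 := hR₀ R R hR1 hR le_rfl y hyR
        have h4 : ‖f y - f 0‖ ≤ ε / 2 * ω R :=
          le_of_mul_le_mul_right (by linarith) hR
        calc _ ≤ ‖f y - f 0‖ :=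
              mul_le_of_le_one_left (norm_nonneg _) (abs_radialCutoff_sub_le_one R x y)
          _ ≤ ε / 2 * ω R := h4
          _ ≤ ε / 2 * ω ‖x - y‖ := by gcongr; exact hω.2.1 _ _ hR ht
    · rw [radialCutoff_eq_zero hR hyR.le, radialCutoff_eq_zero hR (hyR.le.trans hle), sub_zero,
        abs_zero, zero_mul]
      positivity
  rw [hid]
  have := norm_sub_le ((1 - radialCutoff R x) • (f x - f y))
    ((radialCutoff R x - radialCutoff R y) • (f y - f 0))
  linarith

end Truncation

section Closure

variable {X Y : Type*} [NormedAddCommGroup X] [NormedAddCommGroup Y]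

lemma BddSupp.vcFar {ω : ℝ → ℝ} (hω : Admissible ω) {g : X → Y} (hg : HolderFinite ω g)
    (hs : BddSupp g) : VCfar ω g := by
  obtain ⟨R, hR⟩ := hs
  refine ⟨hg, fun ε hε => ⟨max R 1, by positivity, fun x y hxy hx hy => ?_⟩⟩
  rw [hR x ((le_max_left _ _).trans_lt hx), hR y ((le_max_left _ _).trans_lt hy), sub_zero,
    norm_zero]
  exact mul_nonneg hε.le (hω.1 _ (norm_pos_iff.2 (sub_ne_zero.2 hxy))).le

lemma BddSupp.vcLarge {ω : ℝ → ℝ} (hω : Admissible ω) {g : X → Y} (hg : HolderFinite ω g)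
    (hs : BddSupp g) : VClarge ω g := by
  obtain ⟨M, hM0, hM⟩ := hg.exists_nonneg hω
  obtain ⟨R, hR⟩ := hs
  have hR1 : 0 < max R 1 := by positivity
  set B := M * ω (max R 1) + ‖g 0‖ with hB
  have hB0 : 0 ≤ B := add_nonneg (mul_nonneg hM0 (hω.1 _ hR1).le) (norm_nonneg _)
  have hbound : ∀ x, ‖g x‖ ≤ B := fun x => by
    rcases le_or_gt ‖x‖ (max R 1) with hx | hx
    · have := hM.norm_sub_zero_le hω hM0 hR1 hx
      have := norm_le_norm_sub_add (g x) (g 0)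
      linarith
    · rwa [hR x ((le_max_left _ _).trans_lt hx), norm_zero]
  refine ⟨hg, fun ε hε => ?_⟩
  obtain ⟨S, hS⟩ := eventually_atTop.1 (hω.2.2.2.1.eventually_ge_atTop (2 * B / ε))
  refine ⟨max S 1, by positivity, fun x y hxy => ?_⟩
  have h1 := hS _ ((le_max_left _ _).trans hxy.le)
  rw [div_le_iff₀ hε] at h1
  have := norm_sub_le (g x) (g y)
  have := hbound x
  have := hbound y
  linarith

lemma norm_sub_le_of_holderLE_sub {ω : ℝ → ℝ} {f g : X → Y} {ε : ℝ}
    (h : HolderLE ω (fun x => f x - g x) (ε / 2)) {x y : X} (hxy : x ≠ y)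
    (hg : ‖g x - g y‖ ≤ ε / 2 * ω ‖x - y‖) : ‖f x - f y‖ ≤ ε * ω ‖x - y‖ := by
  have h1 := h x y hxy
  have h2 := norm_add_le (f x - g x - (f y - g y)) (g x - g y)
  rw [show f x - g x - (f y - g y) + (g x - g y) = f x - f y by abel] at h2
  linarith

end Closure

/-- Theorem 1.2: `VC^{0,ω}(X,Y)` is the closure, in the `Ċ^{0,ω}` seminorm, of the
continuous, boundedly supported members of `VC^{0,ω}_small(X,Y)`. -/
theorem vc_eq_closure_of_vcsmall_bs
    {X Y : Type*} [NormedAddCommGroup X] [NormedSpace ℝ X]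
    [NormedAddCommGroup Y] [NormedSpace ℝ Y]
    (ω : ℝ → ℝ) (hω : Admissible ω) (f : X → Y) :
    VCfull ω f ↔
      (HolderFinite ω f ∧ ∀ ε : ℝ, 0 < ε → ∃ g : X → Y,
        VCsmall ω g ∧ Continuous g ∧ BddSupp g ∧
        HolderLE ω (fun x => f x - g x) ε) := by
  constructor
  · rintro ⟨hsmall, hlarge, hfar⟩
    refine ⟨hsmall.1, fun ε hε => ?_⟩
    obtain ⟨R, hR, hle⟩ := exists_truncation_holderLE hω hlarge hfar hε
    obtain ⟨M, hM⟩ := hsmall.1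
    have hfin : HolderFinite ω (truncation R f) := by
      refine ⟨M + ε, fun x y hxy => ?_⟩
      have h1 := hM x y hxy
      have h2 := hle x y hxy
      have h3 := norm_sub_le (f x - f y) (f x - truncation R f x - (f y - truncation R f y))
      rw [show f x - f y - (f x - truncation R f x - (f y - truncation R f y))
        = truncation R f x - truncation R f y by abel] at h3
      linarith
    exact ⟨truncation R f, hsmall.truncation hω hR hfin, hfin.continuous hω,
      bddSupp_truncation hR f, hle⟩
  · rintro ⟨hfin, happ⟩
    refine ⟨⟨hfin, fun ε hε => ?_⟩, ⟨hfin, fun ε hε => ?_⟩, ⟨hfin, fun ε hε => ?_⟩⟩ <;>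
      obtain ⟨g, hg, -, hs, hle⟩ := happ (ε / 2) (half_pos hε)
    · obtain ⟨δ, hδ, h⟩ := hg.2 (ε / 2) (half_pos hε)
      exact ⟨δ, hδ, fun x y hxy hd => norm_sub_le_of_holderLE_sub hle hxy (h x y hxy hd)⟩
    · obtain ⟨δ, hδ, h⟩ := (hs.vcLarge hω hg.1).2 (ε / 2) (half_pos hε)
      exact ⟨δ, hδ, fun x y hd => norm_sub_le_of_holderLE_sub hle
        (sub_ne_zero.1 (norm_pos_iff.1 (hδ.trans hd))) (h x y hd)⟩
    · obtain ⟨δ, hδ, h⟩ := (hs.vcFar hω hg.1).2 (ε / 2) (half_pos hε)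
      exact ⟨δ, hδ, fun x y hxy hx hy =>
        norm_sub_le_of_holderLE_sub hle hxy (h x y hxy hx hy)⟩
end

section
/- Let k ∈ ℕ ∪ {∞} and let X be a separable normed space admitting a C^k and Lipschitz bump function, and let ω be an admissible modulus. Then the closure, in the Ċ^{0,ω}(X,ℝ) seminorm, of the set of real-valued functions on X that are simultaneously of class C^k, Lipschitz, and in Ċ^{0,ω}(X,ℝ), equals VC^{0,ω}_small(X,ℝ). -/
open Filter Set

/-- A smooth ramp: zero on the negative axis, at least `x - 1`, with slope in `[0, 1]`. -/
noncomputable def smoothRamp (x : ℝ) : ℝ := x * expNegInvGlue x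

theorem smoothRamp_contDiff {n : WithTop ℕ∞} (hn : n ≤ ((⊤ : ℕ∞) : WithTop ℕ∞)) :
    ContDiff ℝ n smoothRamp := by
  have h : ContDiff ℝ ((⊤ : ℕ∞) : WithTop ℕ∞) smoothRamp :=
    contDiff_id.mul expNegInvGlue.contDiff
  exact h.of_le hn

theorem smoothRamp_of_nonpos {x : ℝ} (hx : x ≤ 0) : smoothRamp x = 0 := by
  simp [smoothRamp, expNegInvGlue.zero_of_nonpos hx]

theorem smoothRamp_of_pos {x : ℝ} (hx : 0 < x) : smoothRamp x = x * Real.exp (-x⁻¹) := by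
  simp [smoothRamp, expNegInvGlue, not_le.mpr hx]

theorem smoothRamp_nonneg (x : ℝ) : 0 ≤ smoothRamp x := by
  rcases le_or_gt x 0 with hx | hx
  · rw [smoothRamp_of_nonpos hx]
  · exact mul_nonneg hx.le (expNegInvGlue.nonneg x)

theorem smoothRamp_le_self {x : ℝ} (hx : 0 ≤ x) : smoothRamp x ≤ x := by
  rcases hx.eq_or_lt with rfl | hx
  · simp [smoothRamp]
  · rw [smoothRamp_of_pos hx]
    have : Real.exp (-x⁻¹) ≤ 1 := Real.exp_le_one_iff.mpr (by simpa using hx.le)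
    nlinarith

theorem sub_one_le_smoothRamp (x : ℝ) : x - 1 ≤ smoothRamp x := by
  rcases le_or_gt x 0 with hx | hx
  · rw [smoothRamp_of_nonpos hx]; linarith
  · rw [smoothRamp_of_pos hx]
    have h := mul_le_mul_of_nonneg_left (Real.add_one_le_exp (-x⁻¹)) hx.le
    have : x * (-x⁻¹ + 1) = x - 1 := by field_simp; ring
    linarith

theorem smoothRamp_mono : Monotone smoothRamp := by
  intro x y hxy
  rcases le_or_gt x 0 with hx | hx
  · rw [smoothRamp_of_nonpos hx]; exact smoothRamp_nonneg y
  · have hy := hx.trans_le hxy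
    rw [smoothRamp_of_pos hx, smoothRamp_of_pos hy]
    gcongr

theorem smoothRamp_sub_le {x y : ℝ} (hxy : x ≤ y) : smoothRamp y - smoothRamp x ≤ y - x := by
  rcases le_or_gt x 0 with hx | hx
  · rw [smoothRamp_of_nonpos hx]
    rcases le_or_gt y 0 with hy | hy
    · rw [smoothRamp_of_nonpos hy]; linarith
    · linarith [smoothRamp_le_self hy.le]
  · have hy := hx.trans_le hxy
    rw [smoothRamp_of_pos hx, smoothRamp_of_pos hy]
    have e1 : Real.exp (-y⁻¹) * (1 + y⁻¹ - x⁻¹) ≤ Real.exp (-x⁻¹) := by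
      have := mul_le_mul_of_nonneg_left (Real.add_one_le_exp (y⁻¹ - x⁻¹)) (Real.exp_pos (-y⁻¹)).le
      rw [← Real.exp_add] at this
      have e : -y⁻¹ + (y⁻¹ - x⁻¹) = -x⁻¹ := by ring
      rw [e] at this
      linarith
    have e2 : Real.exp (-y⁻¹) * (1 + y⁻¹) ≤ 1 := by
      have := mul_le_mul_of_nonneg_left (Real.add_one_le_exp (y⁻¹)) (Real.exp_pos (-y⁻¹)).le
      rw [← Real.exp_add] at this
      simpa [add_comm] using this
    have e3 := mul_le_mul_of_nonneg_left e1 hx.le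
    have e4 := mul_le_mul_of_nonneg_left e2 (sub_nonneg.mpr hxy)
    have e5 : x * (Real.exp (-y⁻¹) * (1 + y⁻¹ - x⁻¹)) =
        y * Real.exp (-y⁻¹) - (y - x) * (Real.exp (-y⁻¹) * (1 + y⁻¹)) := by
      field_simp; ring
    linarith

theorem abs_smoothRamp_sub_le (x y : ℝ) : |smoothRamp x - smoothRamp y| ≤ |x - y| := by
  rcases le_total x y with h | h
  · rw [abs_sub_comm, abs_sub_comm x, abs_of_nonneg (sub_nonneg.mpr (smoothRamp_mono h)),
      abs_of_nonneg (sub_nonneg.mpr h)]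
    exact smoothRamp_sub_le h
  · rw [abs_of_nonneg (sub_nonneg.mpr (smoothRamp_mono h)), abs_of_nonneg (sub_nonneg.mpr h)]
    exact smoothRamp_sub_le h

/-- A smooth substitute for `max a b`, equal to `a` as soon as `b ≤ a - 1`. -/
noncomputable def softMax (a b : ℝ) : ℝ := a + smoothRamp (b - a + 1)

theorem softMax_eq_left {a b : ℝ} (h : b ≤ a - 1) : softMax a b = a := by
  rw [softMax, smoothRamp_of_nonpos (by linarith), add_zero]

theorem le_softMax_left (a b : ℝ) : a ≤ softMax a b :=
  le_add_of_nonneg_right (smoothRamp_nonneg _)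

theorem le_softMax_right (a b : ℝ) : b ≤ softMax a b := by
  have := sub_one_le_smoothRamp (b - a + 1)
  unfold softMax; linarith

theorem abs_softMax_sub_le {a b a' b' D : ℝ} (ha : |a - a'| ≤ D) (hb : |b - b'| ≤ D) :
    |softMax a b - softMax a' b'| ≤ D := by
  unfold softMax
  rw [abs_le] at *
  rcases le_total (b - a + 1) (b' - a' + 1) with h | h
  · have h1 := smoothRamp_mono h
    have h2 := smoothRamp_sub_le h
    constructor <;> linarith
  · have h1 := smoothRamp_mono h
    have h2 := smoothRamp_sub_le h
    constructor <;> linarith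

/-- The iterated smooth maximum of `0, p 0, …, p (n - 1)`. -/
noncomputable def softMaxSeq (p : ℕ → ℝ) : ℕ → ℝ
  | 0 => 0
  | n + 1 => softMax (softMaxSeq p n) (p n)

theorem softMaxSeq_mono (p : ℕ → ℝ) : Monotone (softMaxSeq p) :=
  monotone_nat_of_le_succ fun _ => le_softMax_left _ _

theorem softMaxSeq_nonneg (p : ℕ → ℝ) (n : ℕ) : 0 ≤ softMaxSeq p n :=
  softMaxSeq_mono p (Nat.zero_le n)

theorem le_softMaxSeq (p : ℕ → ℝ) {j n : ℕ} (h : j < n) : p j ≤ softMaxSeq p n :=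
  (le_softMax_right _ _).trans (softMaxSeq_mono p (Nat.succ_le_of_lt h))

theorem softMaxSeq_eq_of_le (p : ℕ → ℝ) {j n : ℕ} (hjn : j ≤ n)
    (h : ∀ i, j ≤ i → i < n → p i ≤ -1) : softMaxSeq p n = softMaxSeq p j := by
  induction n, hjn using Nat.le_induction with
  | base => rfl
  | succ n hn ih =>
    rw [← ih fun i hi hin => h i hi (hin.trans n.lt_succ_self)]
    exact softMax_eq_left (by linarith [softMaxSeq_nonneg p n, h n hn n.lt_succ_self])

theorem abs_softMaxSeq_sub_le {p q : ℕ → ℝ} {D : ℝ} (h : ∀ n, |p n - q n| ≤ D) (n : ℕ) :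
    |softMaxSeq p n - softMaxSeq q n| ≤ D := by
  induction n with
  | zero => simpa [softMaxSeq] using (abs_nonneg _).trans (h 0)
  | succ n ih => exact abs_softMax_sub_le ih (h n)

section SmoothSeparation

variable {X : Type*} [NormedAddCommGroup X] [NormedSpace ℝ X]

theorem contDiff_softMaxSeq {k : ℕ∞} {p : ℕ → X → ℝ} (hp : ∀ n, ContDiff ℝ k (p n)) (n : ℕ) :
    ContDiff ℝ k fun x => softMaxSeq (fun j => p j x) n := by
  induction n with
  | zero => exact contDiff_const
  | succ n ih =>
    exact ih.add ((smoothRamp_contDiff (mod_cast le_top)).comp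
      (((hp n).sub ih).add contDiff_const))

/-- A Lipschitz `C^k` bump can be normalised to be supported in the unit ball with value `5`
at the origin. -/
theorem exists_normalized_bump {k : ℕ∞}
    (hbump : ∃ φ : X → ℝ, φ ≠ 0 ∧ ContDiff ℝ k φ ∧ (∃ L, LipschitzWith L φ) ∧ BddSupp φ) :
    ∃ (a : X → ℝ) (L : ℝ), ContDiff ℝ k a ∧ 0 ≤ L ∧ (∀ x y, |a x - a y| ≤ L * ‖x - y‖) ∧
      a 0 = 5 ∧ ∀ x, 1 ≤ ‖x‖ → a x = 0 := by
  obtain ⟨φ, hφ0, hφ, ⟨L, hL⟩, R, hR⟩ := hbump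
  obtain ⟨p, hp⟩ := Function.ne_iff.mp hφ0
  simp only [Pi.zero_apply] at hp
  set r : ℝ := |R| + ‖p‖ + 1 with hr
  have hr0 : 0 < r := by positivity
  refine ⟨fun x => 5 / φ p * φ (p + r • x), |5 / φ p| * (L * r), ?_, by positivity, ?_, ?_, ?_⟩
  · exact contDiff_const.mul (hφ.comp (contDiff_const.add (contDiff_id.const_smul r)))
  · intro x y
    rw [← mul_sub, abs_mul, mul_assoc]
    gcongr
    have h := hL.dist_le_mul (p + r • x) (p + r • y)
    rw [Real.dist_eq, dist_eq_norm, add_sub_add_left_eq_sub, ← smul_sub, norm_smul,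
      Real.norm_of_nonneg hr0.le] at h
    linarith
  · simp [hp]
  · intro x hx
    have h1 : ‖r • x‖ ≤ ‖p + r • x‖ + ‖p‖ := by
      simpa using norm_sub_le (p + r • x) p
    rw [norm_smul, Real.norm_of_nonneg hr0.le] at h1
    have h2 : r ≤ r * ‖x‖ := le_mul_of_one_le_right hr0.le hx
    have h3 : φ (p + r • x) = 0 := hR _ (by linarith [le_abs_self R])
    simp only [h3, mul_zero]

/-- A nonnegative function oscillating by at most one on unit balls is at bounded distance from a
`C^k` function with a uniform local Lipschitz constant. -/
theorem exists_smooth_approx_of_nonneg {k : ℕ∞} {C : ℝ} (hC : 0 ≤ C)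
    (hsep : ∀ J : Set X, ∃ u : X → ℝ, ContDiff ℝ k u ∧
      (∀ x y, |u x - u y| ≤ C * ‖x - y‖) ∧ (∀ x, 0 ≤ u x) ∧ (∀ x, u x ≤ 1) ∧
      (∀ x, (∀ y, ‖x - y‖ < 1 → y ∈ J) → u x = 1) ∧
      (∀ x, (∀ y, ‖x - y‖ < 1 → y ∉ J) → u x = 0))
    {F : X → ℝ} (hF0 : ∀ x, 0 ≤ F x) (hF : ∀ x y, ‖x - y‖ ≤ 1 → |F x - F y| ≤ 1) :
    ∃ g : X → ℝ, ContDiff ℝ k g ∧ (∀ x y, ‖x - y‖ ≤ 1 → |g x - g y| ≤ 5 * C * ‖x - y‖) ∧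
      ∀ x, |F x - g x| ≤ 2 := by
  choose u huc huL hu0 hu1 hone hzero using fun m : ℕ => hsep {y | (m : ℝ) + 1 < F y}
  have hone' : ∀ (m : ℕ) x, (m : ℝ) + 2 < F x → u m x = 1 := fun m x h => hone m x fun y hy => by
    have := (abs_le.mp (hF x y hy.le)).2
    change (m : ℝ) + 1 < F y
    linarith
  have hzero' : ∀ (m : ℕ) x, F x ≤ m → u m x = 0 := fun m x h => hzero m x fun y hy hy' => by
    have := (abs_le.mp (hF x y hy.le)).1
    change (m : ℝ) + 1 < F y at hy'
    linarith
  set g : X → ℝ := fun x => ∑ m ∈ Finset.range ⌈F x⌉₊, u m x with hg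
  have hgN : ∀ x (N : ℕ), F x ≤ N → g x = ∑ m ∈ Finset.range N, u m x := fun x N hN => by
    refine Finset.sum_subset (Finset.range_mono (Nat.ceil_le.mpr hN)) fun m _ hm => ?_
    rw [Finset.mem_range, not_lt] at hm
    exact hzero' m x (Nat.ceil_le.mp hm)
  refine ⟨g, ?_, ?_, ?_⟩
  · rw [contDiff_iff_contDiffAt]
    intro x
    have hs : ContDiff ℝ k fun y => ∑ m ∈ Finset.range ⌈F x + 1⌉₊, u m y :=
      ContDiff.sum fun m _ => huc m
    refine hs.contDiffAt.congr_of_eventuallyEq ?_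
    filter_upwards [Metric.ball_mem_nhds x one_pos] with y hy
    rw [Metric.mem_ball, dist_eq_norm] at hy
    exact hgN y _ (by linarith [(abs_le.mp (hF y x hy.le)).2, Nat.le_ceil (F x + 1)])
  · intro x y hxy
    have hFxy := abs_le.mp (hF x y hxy)
    set N := ⌈F x + 1⌉₊
    set N₀ := ⌈F x - 3⌉₊
    have hN : F x + 1 ≤ N := Nat.le_ceil _
    have hN' : (N : ℝ) < F x + 1 + 1 := Nat.ceil_lt_add_one (by linarith [hF0 x])
    have hN₀ : F x - 3 ≤ N₀ := Nat.le_ceil _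
    have hle : N₀ ≤ N := Nat.ceil_mono (by linarith)
    have hlow : ∑ m ∈ Finset.range N₀, (u m x - u m y) = 0 :=
      Finset.sum_eq_zero fun m hm => by
        have : (m : ℝ) < F x - 3 := Nat.lt_ceil.mp (Finset.mem_range.mp hm)
        rw [hone' m x (by linarith), hone' m y (by linarith), sub_self]
    rw [hgN x N (by linarith), hgN y N (by linarith), ← Finset.sum_sub_distrib,
      ← Finset.sum_range_add_sum_Ico _ hle, hlow, zero_add]
    refine (Finset.abs_sum_le_sum_abs _ _).trans ?_
    refine (Finset.sum_le_card_nsmul _ _ _ fun m _ => huL m x y).trans ?_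
    rw [Nat.card_Ico, nsmul_eq_mul, Nat.cast_sub hle, mul_assoc]
    exact mul_le_mul_of_nonneg_right (by linarith) (by positivity)
  · intro x
    have hup : g x ≤ F x + 1 := by
      have h1 : g x ≤ ⌈F x⌉₊ := by
        simpa using Finset.sum_le_card_nsmul (Finset.range ⌈F x⌉₊) (fun m => u m x) 1
          fun m _ => hu1 m x
      linarith [Nat.ceil_lt_add_one (hF0 x)]
    have hlo : F x - 2 ≤ g x := by
      have h1 : ∑ m ∈ Finset.range ⌈F x - 2⌉₊, u m x = (⌈F x - 2⌉₊ : ℝ) := by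
        have h : ∀ m ∈ Finset.range ⌈F x - 2⌉₊, u m x = 1 := fun m hm =>
          hone' m x (by linarith [Nat.lt_ceil.mp (Finset.mem_range.mp hm)])
        rw [Finset.sum_congr rfl h]
        simp
      have h2 : ∑ m ∈ Finset.range ⌈F x - 2⌉₊, u m x ≤ g x :=
        Finset.sum_le_sum_of_subset_of_nonneg
          (Finset.range_mono (Nat.ceil_mono (by linarith))) fun m _ _ => hu0 m x
      linarith [Nat.le_ceil (F x - 2)]
    rw [abs_le]
    constructor <;> linarith

/-- A Lipschitz estimate at distances at most one propagates to all distances. -/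
theorem abs_sub_le_of_local {g : X → ℝ} {C : ℝ}
    (h : ∀ x y, ‖x - y‖ ≤ 1 → |g x - g y| ≤ C * ‖x - y‖) (x y : X) :
    |g x - g y| ≤ C * ‖x - y‖ := by
  have key : ∀ (n : ℕ) (x y : X), ‖x - y‖ ≤ 2 ^ n → |g x - g y| ≤ C * ‖x - y‖ := by
    intro n
    induction n with
    | zero => simpa using h
    | succ n ih =>
      intro x y hxy
      have e1 : ‖x - midpoint ℝ x y‖ = 1 / 2 * ‖x - y‖ := by
        rw [← dist_eq_norm, dist_left_midpoint, dist_eq_norm]; norm_num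
      have e2 : ‖midpoint ℝ x y - y‖ = 1 / 2 * ‖x - y‖ := by
        rw [← dist_eq_norm, dist_midpoint_right, dist_eq_norm]; norm_num
      rw [pow_succ] at hxy
      have h1 := ih x (midpoint ℝ x y) (by linarith)
      have h2 := ih (midpoint ℝ x y) y (by linarith)
      have h3 := abs_sub_le (g x) (g (midpoint ℝ x y)) (g y)
      rw [e1] at h1
      rw [e2] at h2
      linarith
  obtain ⟨n, hn⟩ := pow_unbounded_of_one_lt ‖x - y‖ (one_lt_two (α := ℝ))
  exact key n x y hn.le

variable [TopologicalSpace.SeparableSpace X]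

/-- A set can be smoothly separated from points at distance at least one, with a Lipschitz
constant independent of the set. -/
theorem exists_smooth_separation {k : ℕ∞} {a : X → ℝ} {L : ℝ} (ha : ContDiff ℝ k a) (hL : 0 ≤ L)
    (haL : ∀ x y, |a x - a y| ≤ L * ‖x - y‖) (ha0 : a 0 = 5) (ha1 : ∀ x, 1 ≤ ‖x‖ → a x = 0) :
    ∃ C : ℝ, 0 ≤ C ∧ ∀ J : Set X, ∃ u : X → ℝ, ContDiff ℝ k u ∧
      (∀ x y, |u x - u y| ≤ C * ‖x - y‖) ∧ (∀ x, 0 ≤ u x) ∧ (∀ x, u x ≤ 1) ∧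
      (∀ x, (∀ y, ‖x - y‖ < 1 → y ∈ J) → u x = 1) ∧
      (∀ x, (∀ y, ‖x - y‖ < 1 → y ∉ J) → u x = 0) := by
  classical
  set K : ℝ := 5 + L + 1 with hK
  have hK0 : 0 ≤ K := by positivity
  have haK : ∀ x, a x ≤ K - 1 := by
    intro x
    rcases le_or_gt 1 ‖x‖ with h | h
    · rw [ha1 x h]; linarith
    · have h1 := (abs_le.mp (haL x 0)).2
      rw [ha0, sub_zero] at h1
      nlinarith
  refine ⟨Real.exp 1 * ((1 + K) * L), by positivity, fun J => ?_⟩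
  set d : ℕ → X := TopologicalSpace.denseSeq X
  have hd : DenseRange d := TopologicalSpace.denseRange_denseSeq X
  set q : ℕ → X → ℝ := fun j x => K * (a (x - d j) - 3) - 1 with hq
  set P : ℕ → X → ℝ := fun n x => softMaxSeq (fun j => q j x) n with hP
  set t : ℕ → X → ℝ := fun n x => if d n ∈ J then a (x - d n) - P n x - 1 else -1 with ht
  set M : ℕ → X → ℝ := fun n x => softMaxSeq (fun j => t j x) n with hM
  have hac : ∀ n, ContDiff ℝ k fun x => a (x - d n) := fun n =>
    ha.comp (contDiff_id.sub contDiff_const)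
  have haLd : ∀ n x y, |a (x - d n) - a (y - d n)| ≤ L * ‖x - y‖ := fun n x y => by
    simpa using haL (x - d n) (y - d n)
  have hPc : ∀ n, ContDiff ℝ k (P n) := contDiff_softMaxSeq fun n =>
    (contDiff_const.mul ((hac n).sub contDiff_const)).sub contDiff_const
  have hPL : ∀ n x y, |P n x - P n y| ≤ K * (L * ‖x - y‖) := fun n x y => by
    refine abs_softMaxSeq_sub_le (fun j => ?_) n
    have : q j x - q j y = K * (a (x - d j) - a (y - d j)) := by simp only [hq]; ring
    rw [this, abs_mul, abs_of_nonneg hK0]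
    exact mul_le_mul_of_nonneg_left (haLd j x y) hK0
  have htc : ∀ n, ContDiff ℝ k (t n) := fun n => by
    by_cases h : d n ∈ J
    · simp only [ht, h, if_true]
      exact ((hac n).sub (hPc n)).sub contDiff_const
    · simp only [ht, h, if_false]
      exact contDiff_const
  have htL : ∀ n x y, |t n x - t n y| ≤ (1 + K) * L * ‖x - y‖ := fun n x y => by
    by_cases h : d n ∈ J
    · simp only [ht, h, if_true]
      have h1 := abs_le.mp (haLd n x y)
      have h2 := abs_le.mp (hPL n x y)
      rw [abs_le]
      constructor <;> linarith
    · simp only [ht, h, if_false, sub_self, abs_zero]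
      positivity
  have hMc : ∀ n, ContDiff ℝ k (M n) := contDiff_softMaxSeq htc
  have hML : ∀ n x y, |M n x - M n y| ≤ (1 + K) * L * ‖x - y‖ := fun n x y =>
    abs_softMaxSeq_sub_le (fun j => htL j x y) n
  have hPnn : ∀ n x, 0 ≤ P n x := fun n x => softMaxSeq_nonneg _ n
  have ht_le : ∀ n x, (d n ∈ J → a (x - d n) ≤ P n x) → t n x ≤ -1 := fun n x h => by
    by_cases hn : d n ∈ J
    · simp only [ht, hn, if_true]; linarith [h hn]
    · simp only [ht, hn, if_false]; exact le_rfl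
  have hstab : ∀ j n x, 4 < a (x - d j) → j < n → M n x = M (j + 1) x := fun j n x hj hjn => by
    refine softMaxSeq_eq_of_le _ hjn fun i hi _ => ht_le i x fun _ => ?_
    have h1 : q j x ≤ P i x := le_softMaxSeq (fun j => q j x) (Nat.lt_of_succ_le hi)
    have h2 : K * 1 ≤ K * (a (x - d j) - 3) := mul_le_mul_of_nonneg_left (by linarith) hK0
    have h3 : q j x = K * (a (x - d j) - 3) - 1 := rfl
    linarith [haK (x - d i)]
  have hex : ∀ x, ∃ j, 4 < a (x - d j) := fun x => by
    have ho : IsOpen {z | 4 < a (x - z)} :=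
      isOpen_lt continuous_const (ha.continuous.comp (continuous_const.sub continuous_id))
    exact hd.exists_mem_open ho ⟨x, by simp only [mem_ofPred_eq, sub_self, ha0]; norm_num⟩
  choose N hN using hex
  set G : X → ℝ := fun x => M (N x + 1) x with hG
  have hGM : ∀ j n x, 4 < a (x - d j) → j < n → G x = M n x := fun j n x hj hjn => by
    rw [hstab j n x hj hjn, ← hstab j (max (N x + 1) (j + 1)) x hj (by omega),
      hstab (N x) _ x (hN x) (by omega)]
  have hGc : ContDiff ℝ k G := by
    rw [contDiff_iff_contDiffAt]
    intro x
    refine (hMc (N x + 1)).contDiffAt.congr_of_eventuallyEq ?_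
    have ho : IsOpen {z | 4 < a (z - d (N x))} := isOpen_lt continuous_const (hac _).continuous
    filter_upwards [ho.mem_nhds (hN x)] with z hz
    exact hGM _ _ z hz (Nat.lt_succ_self _)
  have hGL : ∀ x y, |G x - G y| ≤ (1 + K) * L * ‖x - y‖ := fun x y => by
    rw [hGM (N x) (max (N x) (N y) + 1) x (hN x) (by omega),
      hGM (N y) (max (N x) (N y) + 1) y (hN y) (by omega)]
    exact hML _ x y
  have hE : Real.exp 1 * smoothRamp 1 = 1 := by
    rw [smoothRamp_of_pos one_pos, one_mul, ← Real.exp_add]; simp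
  refine ⟨fun x => 1 - Real.exp 1 * smoothRamp (1 - smoothRamp (G x)), ?_, ?_, ?_, ?_, ?_, ?_⟩
  · have hr : ContDiff ℝ k smoothRamp := smoothRamp_contDiff (mod_cast le_top)
    exact contDiff_const.sub (contDiff_const.mul
      (hr.comp (contDiff_const.sub (hr.comp hGc))))
  · intro x y
    rw [sub_sub_sub_cancel_left, ← mul_sub, abs_mul, abs_of_pos (Real.exp_pos 1), mul_assoc]
    gcongr
    refine (abs_smoothRamp_sub_le _ _).trans ?_
    rw [sub_sub_sub_cancel_left]
    exact (abs_smoothRamp_sub_le _ _).trans (hGL x y)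
  · intro x
    have h := smoothRamp_mono (show 1 - smoothRamp (G x) ≤ 1 by linarith [smoothRamp_nonneg (G x)])
    have := mul_le_mul_of_nonneg_left h (Real.exp_pos 1).le
    simp only
    linarith
  · intro x
    have := mul_nonneg (Real.exp_pos 1).le (smoothRamp_nonneg (1 - smoothRamp (G x)))
    simp only
    linarith
  · intro x hx
    have hex3 : ∃ j, 3 ≤ a (x - d j) := ⟨N x, by linarith [hN x]⟩
    set n := Nat.find hex3
    have hn : 3 ≤ a (x - d n) := Nat.find_spec hex3
    have hP0 : P n x = 0 := by
      refine softMaxSeq_eq_of_le (fun j => q j x) (Nat.zero_le n) fun i _ hi => ?_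
      have h1 : a (x - d i) < 3 := not_le.mp (Nat.find_min hex3 hi)
      have : K * (a (x - d i) - 3) ≤ 0 := mul_nonpos_of_nonneg_of_nonpos hK0 (by linarith)
      simp only [hq]; linarith
    have hnJ : d n ∈ J := hx _ <| by
      by_contra! h
      linarith [ha1 _ h]
    have htn : 2 ≤ t n x := by
      simp only [ht, hnJ, if_true, hP0]; linarith
    have hG2 : 2 ≤ G x := by
      rw [hGM (N x) (max (N x) n + 1) x (hN x) (by omega)]
      exact htn.trans (le_softMaxSeq (fun j => t j x) (by omega))
    have := sub_one_le_smoothRamp (G x)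
    simp only
    rw [smoothRamp_of_nonpos (by linarith)]
    ring
  · intro x hx
    have hG0 : G x = 0 := by
      refine softMaxSeq_eq_of_le (fun j => t j x) (Nat.zero_le _) fun i _ _ => ht_le i x fun hi => ?_
      have h1 : 1 ≤ ‖x - d i‖ := by
        by_contra! h
        exact hx _ h hi
      rw [ha1 _ h1]
      exact hPnn i x
    simp only [hG0, smoothRamp_of_nonpos le_rfl, sub_zero, hE, sub_self]

/-- With a `C^k` Lipschitz bump, every function oscillating by at most one on unit balls is at
distance at most `4` from a `C^k` function whose Lipschitz constant depends only on the space. -/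
theorem exists_smooth_lipschitz_approx {k : ℕ∞}
    (hbump : ∃ φ : X → ℝ, φ ≠ 0 ∧ ContDiff ℝ k φ ∧ (∃ L, LipschitzWith L φ) ∧ BddSupp φ) :
    ∃ C : ℝ, 0 ≤ C ∧ ∀ F : X → ℝ, (∀ x y, ‖x - y‖ ≤ 1 → |F x - F y| ≤ 1) →
      ∃ g : X → ℝ, ContDiff ℝ k g ∧ (∀ x y, |g x - g y| ≤ C * ‖x - y‖) ∧
        ∀ x, |F x - g x| ≤ 4 := by
  obtain ⟨a, L, ha, hL, haL, ha0, ha1⟩ := exists_normalized_bump hbump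
  obtain ⟨C, hC, hsep⟩ := exists_smooth_separation ha hL haL ha0 ha1
  refine ⟨5 * C + 5 * C, by positivity, fun F hF => ?_⟩
  obtain ⟨g, hg, hgL, hgF⟩ := exists_smooth_approx_of_nonneg hC hsep
    (F := fun x => max (F x) 0) (fun x => le_max_right _ _)
    fun x y h => (abs_max_sub_max_le_abs _ _ _).trans (hF x y h)
  obtain ⟨g', hg', hgL', hgF'⟩ := exists_smooth_approx_of_nonneg hC hsep
    (F := fun x => max (-F x) 0) (fun x => le_max_right _ _)
    fun x y h => (abs_max_sub_max_le_abs _ _ _).trans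
      (by rw [neg_sub_neg, abs_sub_comm]; exact hF x y h)
  refine ⟨fun x => g x - g' x, hg.sub hg', abs_sub_le_of_local fun x y h => ?_, fun x => ?_⟩
  · have h1 := abs_le.mp (hgL x y h)
    have h2 := abs_le.mp (hgL' x y h)
    rw [abs_le]
    constructor <;> linarith
  · have h1 := abs_le.mp (hgF x)
    have h2 := abs_le.mp (hgF' x)
    have h3 : F x = max (F x) 0 - max (-F x) 0 := (posPart_sub_negPart (F x)).symm
    rw [abs_le]
    constructor <;> linarith

end SmoothSeparation

/-- Arbitrarily small scales `δ` at which `t / ω t` almost attains its supremum over `t ≤ δ`. -/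
theorem Admissible.exists_good_scale {ω : ℝ → ℝ} (hω : Admissible ω) {δ₀ : ℝ} (hδ₀ : 0 < δ₀) :
    ∃ δ, 0 < δ ∧ δ < δ₀ ∧ ∀ t, 0 < t → t ≤ δ → t / ω t ≤ 2 * (δ / ω δ) := by
  obtain ⟨hpos, hmono, -, -, hlim, -⟩ := hω
  obtain ⟨η, hη, hηlim⟩ := mem_nhdsGT_iff_exists_Ioo_subset.mp
    (hlim (Iio_mem_nhds (zero_lt_one (α := ℝ))))
  have hη : 0 < η := hη
  set c := δ₀ / 2
  have hc : 0 < c := by positivity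
  set S : Set ℝ := (fun t => t / ω t) '' Ioc 0 c
  have hS : BddAbove S := by
    refine ⟨max 1 (c / ω η), ?_⟩
    rintro _ ⟨t, ⟨ht0, htc⟩, rfl⟩
    rcases lt_or_ge t η with h | h
    · exact (le_of_lt (hηlim ⟨ht0, h⟩)).trans (le_max_left _ _)
    · exact (div_le_div₀ hc.le htc (hpos η hη) (hmono η t hη h)).trans (le_max_right _ _)
  have hne : S.Nonempty := ⟨_, c, ⟨hc, le_rfl⟩, rfl⟩
  have hsup : 0 < sSup S :=
    (div_pos hc (hpos c hc)).trans_le (le_csSup hS ⟨c, ⟨hc, le_rfl⟩, rfl⟩)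
  obtain ⟨_, ⟨δ, ⟨hδ, hδc⟩, rfl⟩, hlt⟩ := exists_lt_of_lt_csSup hne (half_lt_self hsup)
  refine ⟨δ, hδ, hδc.trans_lt (half_lt_self hδ₀), fun t ht0 htδ => ?_⟩
  have := le_csSup hS ⟨t, ⟨ht0, htδ.trans hδc⟩, rfl⟩
  simp only at this hlt
  linarith

/-- Lipschitz functions satisfy the small-scale vanishing condition of an admissible modulus. -/
theorem Admissible.lipschitz_small {X : Type*} [NormedAddCommGroup X] {ω : ℝ → ℝ}
    (hω : Admissible ω) {g : X → ℝ} {L : NNReal} (hg : LipschitzWith L g) {ε : ℝ} (hε : 0 < ε) :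
    ∃ δ : ℝ, 0 < δ ∧ ∀ x y : X, x ≠ y → ‖x - y‖ < δ → ‖g x - g y‖ ≤ ε * ω ‖x - y‖ := by
  obtain ⟨hpos, -, -, -, hlim, -⟩ := hω
  have hL : (0 : ℝ) < L + 1 := by positivity
  obtain ⟨δ, hδ, hδlim⟩ := mem_nhdsGT_iff_exists_Ioo_subset.mp
    (hlim (Iio_mem_nhds (div_pos hε hL)))
  refine ⟨δ, hδ, fun x y hxy h => ?_⟩
  have h0 : 0 < ‖x - y‖ := norm_pos_iff.mpr (sub_ne_zero.mpr hxy)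
  have h1 : ‖x - y‖ / ω ‖x - y‖ < ε / (L + 1) := hδlim ⟨h0, h⟩
  rw [div_lt_div_iff₀ (hpos _ h0) hL] at h1
  have h2 := hg.norm_sub_le x y
  linarith

/-- Theorem 1.3 (i): in a separable normed space with a `C^k` Lipschitz bump, the closure of
`C^k ∩ Lip ∩ Ċ^{0,ω}` in the `Ċ^{0,ω}` seminorm equals `VC^{0,ω}_small`. -/
theorem closure_Ck_lip_eq_vcsmall
    {X : Type*} [NormedAddCommGroup X] [NormedSpace ℝ X]
    [TopologicalSpace.SeparableSpace X]
    (k : ℕ∞)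
    (hbump : ∃ φ : X → ℝ, φ ≠ 0 ∧ ContDiff ℝ k φ ∧ (∃ L, LipschitzWith L φ) ∧ BddSupp φ)
    (ω : ℝ → ℝ) (hω : Admissible ω) (f : X → ℝ) :
    VCsmall ω f ↔
      (HolderFinite ω f ∧ ∀ ε : ℝ, 0 < ε → ∃ g : X → ℝ,
        ContDiff ℝ k g ∧ (∃ L, LipschitzWith L g) ∧ HolderFinite ω g ∧
        HolderLE ω (fun x => f x - g x) ε) := by
  constructor
  · rintro ⟨⟨B, hB⟩, hsmall⟩
    refine ⟨⟨B, hB⟩, fun ε hε => ?_⟩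
    obtain ⟨C, hC, happ⟩ := exists_smooth_lipschitz_approx hbump
    set e : ℝ := ε / (9 + 2 * C) with he
    have he0 : 0 < e := by positivity
    have heε : (9 + 2 * C) * e = ε := by rw [he]; field_simp
    obtain ⟨δ₀, hδ₀, hf⟩ := hsmall e he0
    obtain ⟨δ, hδ, hδδ₀, hscale⟩ := hω.exists_good_scale hδ₀
    obtain ⟨hpos, hmono, -⟩ := hω
    set A : ℝ := e * ω δ with hA
    have hA0 : 0 < A := mul_pos he0 (hpos δ hδ)
    obtain ⟨g, hg, hgL, hgF⟩ := happ (fun x => f (δ • x) / A) fun x y hxy => by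
      rcases eq_or_ne x y with rfl | hne
      · simp
      · have hd : ‖δ • x - δ • y‖ = δ * ‖x - y‖ := by
          rw [← smul_sub, norm_smul, Real.norm_of_nonneg hδ.le]
        have hne' : δ • x ≠ δ • y := fun h => hne (smul_right_injective X hδ.ne' h)
        have hd0 : 0 < ‖δ • x - δ • y‖ := norm_pos_iff.mpr (sub_ne_zero.mpr hne')
        have hdδ : ‖δ • x - δ • y‖ ≤ δ := by
          rw [hd]; exact mul_le_of_le_one_right hδ.le hxy
        rw [← sub_div, abs_div, abs_of_pos hA0, div_le_one hA0, ← Real.norm_eq_abs]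
        exact (hf _ _ hne' (hdδ.trans_lt hδδ₀)).trans
          (mul_le_mul_of_nonneg_left (hmono _ _ hd0 hdδ) he0.le)
    set G : X → ℝ := fun x => A * g (δ⁻¹ • x) with hG
    have hGL : ∀ x y, |G x - G y| ≤ A * C / δ * ‖x - y‖ := fun x y => by
      have h := mul_le_mul_of_nonneg_left (hgL (δ⁻¹ • x) (δ⁻¹ • y)) hA0.le
      rw [← smul_sub, norm_smul, Real.norm_of_nonneg (inv_nonneg.mpr hδ.le)] at h
      simp only [hG]
      rw [← mul_sub, abs_mul, abs_of_pos hA0]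
      refine h.trans (le_of_eq ?_)
      ring
    have hGf : ∀ x, |f x - G x| ≤ 4 * A := fun x => by
      have h := mul_le_mul_of_nonneg_left (hgF (δ⁻¹ • x)) hA0.le
      rw [← abs_of_pos hA0, ← abs_mul, abs_of_pos hA0, smul_inv_smul₀ hδ.ne', mul_sub,
        mul_div_cancel₀ _ hA0.ne'] at h
      linarith
    have hclose : HolderLE ω (fun x => f x - G x) ε := fun x y hxy => by
      have h0 : 0 < ‖x - y‖ := norm_pos_iff.mpr (sub_ne_zero.mpr hxy)
      have hω0 := hpos _ h0
      rw [Real.norm_eq_abs, ← heε]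
      rcases le_or_gt ‖x - y‖ δ with h | h
      · have h1 := hf x y hxy (h.trans_lt hδδ₀)
        rw [Real.norm_eq_abs] at h1
        have h2 := hGL x y
        have h3 := hscale _ h0 h
        have h4 : A * C / δ * ‖x - y‖ ≤ 2 * C * e * ω ‖x - y‖ := by
          have hωδ := hpos δ hδ
          rw [div_le_iff₀ hω0] at h3
          have h5 := mul_le_mul_of_nonneg_left h3 (show 0 ≤ A * C / δ by positivity)
          refine h5.trans (le_of_eq ?_)
          rw [hA]
          field_simp
        have h1 := abs_le.mp h1
        have h2 := abs_le.mp h2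
        have h6 : 0 < e * ω ‖x - y‖ := by positivity
        rw [abs_le]
        constructor <;> linarith
      · have h1 := abs_le.mp (hGf x)
        have h2 := abs_le.mp (hGf y)
        have h3 : A ≤ e * ω ‖x - y‖ := mul_le_mul_of_nonneg_left (hmono _ _ hδ h.le) he0.le
        have h4 : 0 ≤ C * (e * ω ‖x - y‖) := by positivity
        rw [abs_le]
        constructor <;> linarith
    refine ⟨G, contDiff_const.mul (hg.comp (contDiff_id.const_smul δ⁻¹)),
      ⟨(A * C / δ).toNNReal, LipschitzWith.of_dist_le_mul fun x y => ?_⟩,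
      ⟨B + ε, fun x y hxy => ?_⟩, hclose⟩
    · rw [Real.dist_eq, dist_eq_norm, Real.coe_toNNReal _ (by positivity)]
      exact hGL x y
    · have h1 := hB x y hxy
      have h2 := hclose x y hxy
      rw [Real.norm_eq_abs] at *
      have h1 := abs_le.mp h1
      have h2 := abs_le.mp h2
      rw [abs_le]
      constructor <;> linarith
  · rintro ⟨hf, happ⟩
    refine ⟨hf, fun ε hε => ?_⟩
    obtain ⟨g, -, ⟨L, hL⟩, -, hfg⟩ := happ (ε / 2) (half_pos hε)
    obtain ⟨δ, hδ, hg⟩ := hω.lipschitz_small hL (half_pos hε)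
    refine ⟨δ, hδ, fun x y hxy h => ?_⟩
    calc ‖f x - f y‖ = ‖(f x - g x - (f y - g y)) + (g x - g y)‖ := by congr 1; ring
      _ ≤ ε / 2 * ω ‖x - y‖ + ε / 2 * ω ‖x - y‖ :=
        (norm_add_le _ _).trans (add_le_add (hfg x y hxy) (hg x y hxy h))
      _ = ε * ω ‖x - y‖ := by ring
end

section
/- Let k ∈ ℕ ∪ {∞} and let X be a separable normed space admitting a C^k and Lipschitz bump function, and let ω be an admissible modulus. Then the closure, in the Ċ^{0,ω}(X,ℝ) seminorm, of the set of real-valued Lipschitz functions on X of class C^k with bounded support, equals VC^{0,ω}(X,ℝ). -/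
open Filter Set

section Smoothing

open scoped ContDiff

/-- A smooth approximation, up to `1/10`, of the positive part on the real line. -/
structure IsSmoothPosPart (θ : ℝ → ℝ) : Prop where
  contDiff : ContDiff ℝ ∞ θ
  mono : Monotone θ
  sub_le : ∀ u v, v ≤ u → θ u - θ v ≤ u - v
  eq_zero : ∀ u ≤ 0, θ u = 0
  le : ∀ u, u - 1 / 10 ≤ θ u

theorem exists_isSmoothPosPart : ∃ θ : ℝ → ℝ, IsSmoothPosPart θ := by
  set s : ℝ → ℝ := fun u => Real.smoothTransition (10 * u) with hs
  have hsc : ContDiff ℝ ∞ s := Real.smoothTransition.contDiff.comp (by fun_prop)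
  have hcont : Continuous s := hsc.continuous
  have hint : ∀ a b, IntervalIntegrable s MeasureTheory.volume a b :=
    fun a b => hcont.intervalIntegrable a b
  set θ : ℝ → ℝ := fun u => ∫ t in (0 : ℝ)..u, s t with hθ
  have hsub : ∀ u v, θ u - θ v = ∫ t in v..u, s t := fun u v =>
    intervalIntegral.integral_interval_sub_left (hint _ _) (hint _ _)
  have h0 : ∀ t, 0 ≤ s t := fun t => Real.smoothTransition.nonneg _
  have h1 : ∀ t, s t ≤ 1 := fun t => Real.smoothTransition.le_one _
  have hmono : Monotone θ := by
    intro v u huv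
    have := intervalIntegral.integral_nonneg (μ := MeasureTheory.volume) huv (fun t _ => h0 t)
    linarith [hsub u v]
  have hder : ∀ u, HasDerivAt θ (s u) u := fun u =>
    intervalIntegral.integral_hasDerivAt_right (hint _ _)
      hcont.aestronglyMeasurable.stronglyMeasurableAtFilter hcont.continuousAt
  have hz : θ 0 = 0 := by simp [hθ]
  have hzero : ∀ u ≤ 0, θ u = 0 := by
    intro u hu
    have : θ 0 - θ u = 0 := by
      rw [hsub, intervalIntegral.integral_congr (g := fun _ => (0 : ℝ))]
      · simp
      · intro t ht
        rw [uIcc_of_le hu] at ht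
        exact Real.smoothTransition.zero_of_nonpos (by linarith [ht.2])
    linarith
  refine ⟨θ, ?_, hmono, ?_, hzero, ?_⟩
  · rw [contDiff_infty_iff_deriv]
    refine ⟨fun u => (hder u).differentiableAt, ?_⟩
    have : deriv θ = s := funext fun u => (hder u).deriv
    rwa [this]
  · intro u v huv
    rw [hsub]
    calc ∫ t in v..u, s t ≤ ∫ t in v..u, (1 : ℝ) :=
          intervalIntegral.integral_mono_on huv (hint _ _) (by simp) (fun t _ => h1 t)
      _ = u - v := by simp
  · intro u
    rcases le_total u (1 / 10) with hu | hu
    · rcases le_total u 0 with h | h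
      · linarith [hzero u h]
      · linarith [hmono h]
    · have : θ u - θ (1 / 10) = u - 1 / 10 := by
        rw [hsub, intervalIntegral.integral_congr (g := fun _ => (1 : ℝ))]
        · simp
        · intro t ht
          rw [uIcc_of_le hu] at ht
          exact Real.smoothTransition.one_of_one_le (by linarith [ht.1])
      linarith [hmono (show (0 : ℝ) ≤ 1 / 10 by norm_num)]

/-- The iterated smooth maximum of `0, u 0, …, u (n - 1)`. -/
def smoothMax (θ : ℝ → ℝ) (u : ℕ → ℝ) : ℕ → ℝ
  | 0 => 0
  | n + 1 => smoothMax θ u n + θ (u n - smoothMax θ u n)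

namespace IsSmoothPosPart

variable {θ : ℝ → ℝ} (hθ : IsSmoothPosPart θ)
include hθ

theorem nonneg (u : ℝ) : 0 ≤ θ u := by
  rcases le_total u 0 with h | h
  · exact (hθ.eq_zero u h).ge
  · exact (hθ.eq_zero 0 le_rfl).ge.trans (hθ.mono h)

theorem le_max (u : ℝ) : θ u ≤ max u 0 := by
  rcases le_total u 0 with h | h
  · rw [hθ.eq_zero u h]; exact le_max_right _ _
  · have := hθ.sub_le u 0 h
    rw [hθ.eq_zero 0 le_rfl] at this
    exact le_max_of_le_left (by linarith)

theorem smoothMax_mono (u : ℕ → ℝ) : Monotone (smoothMax θ u) :=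
  monotone_nat_of_le_succ fun n => by
    simpa [smoothMax] using hθ.nonneg _

theorem smoothMax_nonneg (u : ℕ → ℝ) (n : ℕ) : 0 ≤ smoothMax θ u n :=
  hθ.smoothMax_mono u n.zero_le

theorem smoothMax_le {u : ℕ → ℝ} {c : ℝ} (hc : 0 ≤ c) {n : ℕ} (h : ∀ j < n, u j ≤ c) :
    smoothMax θ u n ≤ c := by
  induction n with
  | zero => simpa [smoothMax] using hc
  | succ n ih =>
    have h1 := ih fun j hj => h j (by omega)
    have h2 := h n (by omega)
    have h3 := hθ.le_max (u n - smoothMax θ u n)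
    rcases max_cases (u n - smoothMax θ u n) 0 with h4 | h4 <;>
      simp only [smoothMax] <;> linarith

theorem le_smoothMax (u : ℕ → ℝ) {n m : ℕ} (h : n < m) : u n - 1 / 10 ≤ smoothMax θ u m := by
  refine le_trans ?_ (hθ.smoothMax_mono u (Nat.succ_le_of_lt h))
  have := hθ.le (u n - smoothMax θ u n)
  simp only [smoothMax]
  linarith

theorem smoothMax_eq_of_eq_zero {u : ℕ → ℝ} {N : ℕ} (h : ∀ n, N ≤ n → u n = 0) {n : ℕ}
    (hn : N ≤ n) : smoothMax θ u n = smoothMax θ u N := by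
  induction n, hn using Nat.le_induction with
  | base => rfl
  | succ n hn ih =>
    simp only [smoothMax]
    rw [hθ.eq_zero _ (by linarith [h n hn, hθ.smoothMax_nonneg u n]), add_zero, ih]

theorem smoothMax_sub_le {u v : ℕ → ℝ} {c : ℝ} (hc : 0 ≤ c) (h : ∀ j, u j - v j ≤ c) (n : ℕ) :
    smoothMax θ u n - smoothMax θ v n ≤ c := by
  induction n with
  | zero => simpa [smoothMax] using hc
  | succ n ih =>
    simp only [smoothMax]
    have hm : θ (u n - smoothMax θ u n) ≤ θ (v n + c - smoothMax θ u n) :=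
      hθ.mono (by linarith [h n])
    have hs := hθ.sub_le (v n + c - smoothMax θ u n) (v n - smoothMax θ v n) (by linarith)
    linarith

theorem contDiff_smoothMax {X : Type*} [NormedAddCommGroup X] [NormedSpace ℝ X] {k : ℕ∞}
    {u : ℕ → X → ℝ} (hu : ∀ j, ContDiff ℝ k (u j)) (n : ℕ) :
    ContDiff ℝ k fun x => smoothMax θ (fun j => u j x) n := by
  induction n with
  | zero => exact contDiff_const
  | succ n ih =>
    exact ih.add ((hθ.contDiff.of_le (by exact_mod_cast le_top)).comp ((hu n).sub ih))

end IsSmoothPosPart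

/-- Smooth Lipschitz transition functions on the line. -/
theorem exists_lipschitz_contDiff_bump (c : ℝ) {r R : ℝ} (hr : 0 < r) (hR : r < R) :
    ∃ S : ℝ → ℝ, ContDiff ℝ ∞ S ∧ (∃ L : ℝ, 0 ≤ L ∧ ∀ s t, |S s - S t| ≤ L * |s - t|) ∧
      (∀ s, 0 ≤ S s) ∧ (∀ s, S s ≤ 1) ∧ (∀ s, |s - c| ≤ r → S s = 1) ∧
      ∀ s, R ≤ |s - c| → S s = 0 := by
  let b : ContDiffBump c := ⟨r, R, hr, hR⟩
  have hb : ContDiff ℝ ∞ b := b.contDiff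
  obtain ⟨L, hL⟩ := hb.lipschitzWith_of_hasCompactSupport b.hasCompactSupport (by simp)
  refine ⟨b, hb, ⟨L, L.2, fun s t => ?_⟩, fun s => b.nonneg, fun s => b.le_one, fun s hs => ?_,
    fun s hs => ?_⟩
  · simpa [Real.dist_eq] using hL.dist_le_mul s t
  · exact b.one_of_mem_closedBall (by simpa [Real.dist_eq] using hs)
  · exact b.zero_of_le_dist (by simpa [Real.dist_eq] using hs)

section Cutoff

variable {X : Type*} [NormedAddCommGroup X] [NormedSpace ℝ X]

/-- A `C^k` and `K`-Lipschitz function with values in `[0,1]` which is `1` on the ball of radius `a`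
and `0` outside the ball of radius `1/2`. -/
structure IsCutoff (k : ℕ∞) (a K : ℝ) (φ : X → ℝ) : Prop where
  contDiff : ContDiff ℝ k φ
  pos : 0 < a
  le_half : a ≤ 1 / 2
  nonneg : ∀ x, 0 ≤ φ x
  le_one : ∀ x, φ x ≤ 1
  eq_one : ∀ x, ‖x‖ ≤ a → φ x = 1
  eq_zero : ∀ x, 1 / 2 ≤ ‖x‖ → φ x = 0
  lip_nonneg : 0 ≤ K
  lip : ∀ x y, |φ x - φ y| ≤ K * ‖x - y‖

theorem exists_isCutoff {k : ℕ∞}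
    (hbump : ∃ φ : X → ℝ, φ ≠ 0 ∧ ContDiff ℝ k φ ∧ (∃ L, LipschitzWith L φ) ∧ BddSupp φ) :
    ∃ (a K : ℝ) (φ : X → ℝ), IsCutoff k a K φ := by
  obtain ⟨φ, hne, hφ, ⟨L, hL⟩, R, hR⟩ := hbump
  obtain ⟨x₀, hx₀⟩ := Function.ne_iff.1 hne
  simp only [Pi.zero_apply] at hx₀
  obtain ⟨S, hS, ⟨LS, hLS0, hLS⟩, hS0, hS1, hSone, hSzero⟩ :=
    exists_lipschitz_contDiff_bump 1 (show (0 : ℝ) < 3 / 5 by norm_num)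
      (show (3 / 5 : ℝ) < 1 by norm_num)
  set c := φ x₀
  set l : ℝ := 2 * (|R| + ‖x₀‖ + 1) with hl
  have hlpos : 0 < l := by positivity
  set φ₁ : X → ℝ := fun x => φ (x₀ + l • x) / c with hφ₁
  set K₁ : ℝ := L * l / |c| with hK₁
  have hK₁0 : 0 ≤ K₁ := by positivity
  have hlip : ∀ x y, |φ₁ x - φ₁ y| ≤ K₁ * ‖x - y‖ := by
    intro x y
    have h := hL.dist_le_mul (x₀ + l • x) (x₀ + l • y)
    rw [Real.dist_eq, dist_add_left, dist_eq_norm, ← smul_sub, norm_smul, Real.norm_eq_abs,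
      abs_of_pos hlpos] at h
    rw [hφ₁, hK₁]
    simp only
    rw [← sub_div, abs_div, div_mul_eq_mul_div]
    gcongr
    linarith
  have hone : φ₁ 0 = 1 := by simp [hφ₁, c, div_self hx₀]
  have hzero : ∀ x, 1 / 2 ≤ ‖x‖ → φ₁ x = 0 := by
    intro x hx
    have h1 : ‖l • x‖ = l * ‖x‖ := by rw [norm_smul, Real.norm_eq_abs, abs_of_pos hlpos]
    have h2 : ‖l • x‖ ≤ ‖x₀ + l • x‖ + ‖x₀‖ := by
      simpa using norm_sub_le (x₀ + l • x) x₀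
    have h3 : l * (1 / 2) ≤ l * ‖x‖ := by gcongr
    simp [hφ₁, hR _ (show R < ‖x₀ + l • x‖ by linarith [le_abs_self R])]
  refine ⟨min (1 / 2) (3 / 5 / (K₁ + 1)), LS * K₁, S ∘ φ₁, ?_, by positivity, min_le_left _ _,
    fun x => hS0 _, fun x => hS1 _, fun x hx => hSone _ ?_, fun x hx => hSzero _ ?_,
    by positivity, fun x y => ?_⟩
  · refine (hS.of_le (by exact_mod_cast le_top)).comp ((hφ.comp ?_).div_const c)
    fun_prop
  · have h1 := hlip x 0
    rw [hone, sub_zero] at h1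
    have h2 : ‖x‖ ≤ 3 / 5 / (K₁ + 1) := hx.trans (min_le_right _ _)
    rw [le_div_iff₀ (by positivity)] at h2
    nlinarith [norm_nonneg x]
  · simp [hzero x hx]
  · calc |S (φ₁ x) - S (φ₁ y)| ≤ LS * |φ₁ x - φ₁ y| := hLS _ _
      _ ≤ LS * (K₁ * ‖x - y‖) := by gcongr; exact hlip x y
      _ = LS * K₁ * ‖x - y‖ := by ring

theorem abs_mul_sub_mul_le {p q r s : ℝ} (hr0 : 0 ≤ r) (hr1 : r ≤ 1) :
    |p * r - q * s| ≤ |p - q| + |q| * |r - s| := by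
  calc |p * r - q * s| = |(p - q) * r + q * (r - s)| := by ring_nf
    _ ≤ |(p - q) * r| + |q * (r - s)| := abs_add_le _ _
    _ = |p - q| * r + |q| * |r - s| := by rw [abs_mul, abs_mul, abs_of_nonneg hr0]
    _ ≤ |p - q| + |q| * |r - s| := by
      gcongr
      exact mul_le_of_le_one_right (abs_nonneg _) hr1

/-- A uniformly Lipschitz and locally finite sequence of `C^k` functions, subordinate to balls of
radius `1/2`, whose supremum is bounded below. -/
theorem IsCutoff.exists_supPartition [TopologicalSpace.SeparableSpace X] {k : ℕ∞} {a K : ℝ}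
    {φ : X → ℝ} (hφ : IsCutoff k a K φ) :
    ∃ (L : ℝ) (c : ℕ → X) (ψ : ℕ → X → ℝ), 0 ≤ L ∧ (∀ n, ContDiff ℝ k (ψ n)) ∧
      (∀ n x, 0 ≤ ψ n x) ∧ (∀ n x, ψ n x ≤ 1) ∧
      (∀ n x y, |ψ n x - ψ n y| ≤ L * ‖x - y‖) ∧
      (∀ n x, ψ n x ≠ 0 → ‖x - c n‖ < 1 / 2) ∧ (∀ x, ∃ n, 1 / 2 ≤ ψ n x) ∧
      ∀ x, ∃ N, ∀ᶠ y in nhds x, ∀ n, N ≤ n → ψ n y = 0 := by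
  obtain ⟨θ, hθ⟩ := exists_isSmoothPosPart
  obtain ⟨β, hβ, ⟨Lβ, hLβ0, hLβ⟩, hβ0, hβ1, hβone, hβzero⟩ :=
    exists_lipschitz_contDiff_bump 0 (show (0 : ℝ) < 1 / 2 by norm_num)
      (show (1 / 2 : ℝ) < 4 / 5 by norm_num)
  set c := TopologicalSpace.denseSeq X
  set u : ℕ → X → ℝ := fun n x => φ (x - c n) with hu
  set P : ℕ → X → ℝ := fun n x => smoothMax θ (fun j => u j x) n with hP
  have hucd : ∀ n, ContDiff ℝ k (u n) := fun n => hφ.contDiff.comp (by fun_prop)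
  have hPcd : ∀ n, ContDiff ℝ k (P n) := fun n => hθ.contDiff_smoothMax hucd n
  have hulip : ∀ n x y, |u n x - u n y| ≤ K * ‖x - y‖ := fun n x y => by
    simpa [hu] using hφ.lip (x - c n) (y - c n)
  have hK := hφ.lip_nonneg
  have hPlip : ∀ n x y, |P n x - P n y| ≤ K * ‖x - y‖ := fun n x y => by
    rw [abs_le]
    constructor
    · have := hθ.smoothMax_sub_le (u := fun j => u j y) (v := fun j => u j x)
        (c := K * ‖x - y‖) (by positivity)
        (fun j => (le_abs_self _).trans (by rw [abs_sub_comm]; exact hulip j x y)) n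
      simp only [hP]; linarith
    · exact hθ.smoothMax_sub_le (by positivity) (fun j => (le_abs_self _).trans (hulip j x y)) n
  have hcover : ∀ x, ∃ n, u n x = 1 := fun x => by
    obtain ⟨n, hn⟩ := (TopologicalSpace.denseRange_denseSeq X).exists_dist_lt x hφ.pos
    exact ⟨n, hφ.eq_one _ (by rw [← dist_eq_norm]; exact hn.le)⟩
  refine ⟨K + Lβ * K, c, fun n x => u n x * β (P n x), by positivity, fun n => ?_, fun n x => ?_,
    fun n x => ?_, fun n x y => ?_, fun n x hx => ?_, fun x => ?_, fun x => ?_⟩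
  · exact (hucd n).mul ((hβ.of_le (by exact_mod_cast le_top)).comp (hPcd n))
  · exact mul_nonneg (hφ.nonneg _) (hβ0 _)
  · exact mul_le_one₀ (hφ.le_one _) (hβ0 _) (hβ1 _)
  · have h1 : |u n y| ≤ 1 := abs_le.2 ⟨by linarith [hφ.nonneg (y - c n)], hφ.le_one _⟩
    calc _ ≤ |u n x - u n y| + |u n y| * |β (P n x) - β (P n y)| :=
          abs_mul_sub_mul_le (hβ0 _) (hβ1 _)
      _ ≤ K * ‖x - y‖ + 1 * (Lβ * (K * ‖x - y‖)) := by
          gcongr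
          · exact hulip n x y
          · exact (hLβ _ _).trans (by gcongr; exact hPlip n x y)
      _ = (K + Lβ * K) * ‖x - y‖ := by ring
  · by_contra! h
    exact hx (by simp [hu, hφ.eq_zero _ h])
  · classical
    have hex : ∃ n, 1 / 2 ≤ u n x := (hcover x).imp fun n hn => by rw [hn]; norm_num
    refine ⟨Nat.find hex, ?_⟩
    have hPle : P (Nat.find hex) x ≤ 1 / 2 := hθ.smoothMax_le (by norm_num)
      fun j hj => (not_le.1 (Nat.find_min hex hj)).le
    beta_reduce
    rw [hβone _ (by rw [sub_zero, abs_of_nonneg (hθ.smoothMax_nonneg _ _)]; exact hPle), mul_one]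
    exact Nat.find_spec hex
  · obtain ⟨n, hn⟩ := hcover x
    have hx : 4 / 5 < P (n + 1) x := by
      have := hθ.le_smoothMax (fun j => u j x) (Nat.lt_succ_self n)
      simp only [hn] at this
      exact lt_of_lt_of_le (by norm_num) this
    refine ⟨n + 1, ?_⟩
    filter_upwards [(hPcd (n + 1)).continuous.continuousAt.eventually (lt_mem_nhds hx)] with y hy m hm
    rw [hβzero, mul_zero]
    rw [sub_zero]
    exact (hy.le.trans (hθ.smoothMax_mono _ hm)).trans (le_abs_self _)

/-- Uniformly Lipschitz `C^k` Urysohn functions. -/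
theorem IsCutoff.exists_urysohn [TopologicalSpace.SeparableSpace X] {k : ℕ∞} {a K : ℝ}
    {φ : X → ℝ} (hφ : IsCutoff k a K φ) :
    ∃ C : ℝ, 0 ≤ C ∧ ∀ A : Set X, ∃ h : X → ℝ, ContDiff ℝ k h ∧ (∀ x, 0 ≤ h x) ∧
      (∀ x, h x ≤ 1) ∧ (∀ x ∈ A, h x = 1) ∧ (∀ x, h x ≠ 0 → ∃ y ∈ A, ‖x - y‖ ≤ 1) ∧
      ∀ x y, |h x - h y| ≤ C * ‖x - y‖ := by
  classical
  obtain ⟨L, c, ψ, hL, hψcd, hψ0, hψ1, hψlip, hψsupp, hψcov, hψfin⟩ := hφ.exists_supPartition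
  obtain ⟨θ, hθ⟩ := exists_isSmoothPosPart
  obtain ⟨S, hS, ⟨LS, hLS0, hLS⟩, hS0, hS1, hSone, hSzero⟩ :=
    exists_lipschitz_contDiff_bump 1 (show (0 : ℝ) < 3 / 5 by norm_num)
      (show (3 / 5 : ℝ) < 1 by norm_num)
  refine ⟨LS * L, by positivity, fun A => ?_⟩
  set v : ℕ → X → ℝ := fun n => if ∃ y ∈ A, ‖y - c n‖ < 1 / 2 then ψ n else 0 with hv
  have hv_or : ∀ n, v n = ψ n ∨ v n = 0 := fun n => by
    simp only [hv]; split_ifs <;> simp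
  have hvcd : ∀ n, ContDiff ℝ k (v n) := fun n => by
    rcases hv_or n with h | h <;> rw [h]
    exacts [hψcd n, contDiff_const]
  have hv1 : ∀ n x, v n x ≤ 1 := fun n x => by
    rcases hv_or n with h | h <;> rw [h]
    exacts [hψ1 n x, zero_le_one]
  have hvlip : ∀ n x y, v n x - v n y ≤ L * ‖x - y‖ := fun n x y => by
    rcases hv_or n with h | h <;> rw [h]
    · exact (le_abs_self _).trans (hψlip n x y)
    · simp only [Pi.zero_apply, sub_zero]; positivity
  set M : X → ℕ → ℝ := fun x n => smoothMax θ (fun j => v j x) n with hM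
  have hMcd : ∀ n, ContDiff ℝ k fun x => M x n := fun n => hθ.contDiff_smoothMax hvcd n
  set H : X → ℝ := fun x => ⨆ n, M x n with hH
  have hbdd : ∀ x, BddAbove (range (M x)) := fun x =>
    ⟨1, by rintro _ ⟨n, rfl⟩; exact hθ.smoothMax_le zero_le_one fun j _ => hv1 j x⟩
  have hHle : ∀ x, H x ≤ 1 := fun x =>
    ciSup_le fun n => hθ.smoothMax_le zero_le_one fun j _ => hv1 j x
  have hMle : ∀ x n, M x n ≤ H x := fun x n => le_ciSup (hbdd x) n
  have hloc : ∀ x, ∃ N, ∀ᶠ y in nhds x, H y = M y N := fun x => by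
    obtain ⟨N, hN⟩ := hψfin x
    refine ⟨N, hN.mono fun y hy => le_antisymm (ciSup_le fun n => ?_) (hMle y N)⟩
    have hz : ∀ n, N ≤ n → v n y = 0 := fun n hn => by
      rcases hv_or n with h | h <;> rw [h]
      exacts [hy n hn, rfl]
    rcases le_total n N with h | h
    · exact hθ.smoothMax_mono _ h
    · exact (hθ.smoothMax_eq_of_eq_zero hz h).le
  have hHcd : ContDiff ℝ k H := contDiff_iff_contDiffAt.2 fun x => by
    obtain ⟨N, hN⟩ := hloc x
    exact (hMcd N).contDiffAt.congr_of_eventuallyEq hN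
  have hHlip : ∀ x y, H x - H y ≤ L * ‖x - y‖ := fun x y => by
    rw [sub_le_iff_le_add]
    refine ciSup_le fun n => ?_
    have := hθ.smoothMax_sub_le (u := fun j => v j x) (v := fun j => v j y)
      (c := L * ‖x - y‖) (by positivity) (fun j => hvlip j x y) n
    have := hMle y n
    simp only [hM] at *
    linarith
  refine ⟨S ∘ H, (hS.of_le (by exact_mod_cast le_top)).comp hHcd, fun x => hS0 _, fun x => hS1 _,
    fun x hx => hSone _ ?_, fun x hx => ?_, fun x y => (hLS _ _).trans ?_⟩
  · obtain ⟨n, hn⟩ := hψcov x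
    have hvn : v n x = ψ n x := by
      simp only [hv]
      rw [if_pos ⟨x, hx, hψsupp n x (by linarith)⟩]
    have h1 := hθ.le_smoothMax (fun j => v j x) (Nat.lt_succ_self n)
    have h2 := hMle x (n + 1)
    simp only [hvn] at h1
    rw [abs_le]
    simp only [hM] at h2
    constructor <;> linarith [hHle x]
  · by_contra! hcon
    have hz : ∀ n, v n x = 0 := fun n => by
      by_contra hne
      simp only [hv] at hne
      split_ifs at hne with hA
      · obtain ⟨y, hyA, hy⟩ := hA
        have h1 := hψsupp n x hne
        have h2 := hcon y hyA
        have h3 := norm_sub_le_norm_sub_add_norm_sub x (c n) y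
        rw [norm_sub_rev (c n) y] at h3
        linarith
      · exact hne rfl
    have : H x = 0 := by
      have h0 : ∀ n, M x n = 0 := fun n => by
        have := hθ.smoothMax_eq_of_eq_zero (u := fun j => v j x) (N := 0)
          (fun n _ => hz n) n.zero_le
        simpa [smoothMax] using this
      simp [hH, h0]
    exact hx (hSzero _ (by simp [this]))
  · rw [mul_assoc]
    gcongr
    rw [abs_le]
    have h1 := hHlip y x
    rw [norm_sub_rev] at h1
    constructor <;> linarith [hHlip x y]

/-- Approximation of bounded functions of coarse oscillation at most `1` by `C^k` functions whose
local Lipschitz constant does not depend on the bound. -/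
theorem IsCutoff.exists_approx [TopologicalSpace.SeparableSpace X] {k : ℕ∞} {a K : ℝ}
    {φ : X → ℝ} (hφ : IsCutoff k a K φ) :
    ∃ C : ℝ, 0 ≤ C ∧ ∀ (N : ℕ) (f : X → ℝ), (∀ x, 0 ≤ f x) → (∀ x, f x ≤ N) →
      (∀ x y, ‖x - y‖ ≤ 1 → |f x - f y| ≤ 1) →
      ∃ g : X → ℝ, ContDiff ℝ k g ∧ (∀ x, |f x - g x| ≤ 1) ∧
        ∀ x y, ‖x - y‖ ≤ 1 → |g x - g y| ≤ C * ‖x - y‖ := by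
  obtain ⟨C, hC, hU⟩ := hφ.exists_urysohn
  refine ⟨3 * C, by positivity, fun N f hf0 hfN hf => ?_⟩
  choose h hcd h0 h1 hone hsupp hlip using fun j : ℕ => hU {x | (j : ℝ) ≤ f x}
  have hzero : ∀ (j : ℕ) x, f x + 1 < j → h j x = 0 := fun j x hj => by
    by_contra hne
    obtain ⟨y, hy, hxy⟩ := hsupp j x hne
    have h2 := (abs_le.1 (hf x y hxy)).1
    simp only [mem_ofPred_eq] at hy
    linarith
  have hsum : ∀ m : ℕ, m ≤ N →
      (∑ j ∈ Finset.Icc 1 N, if j ≤ m then (1 : ℝ) else 0) = m := fun m hm => by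
    rw [← Finset.sum_filter]
    have : (Finset.Icc 1 N).filter (fun j => j ≤ m) = Finset.Icc 1 m := by
      ext j; simp only [Finset.mem_filter, Finset.mem_Icc]; omega
    simp [this]
  refine ⟨fun x => ∑ j ∈ Finset.Icc 1 N, h j x, ContDiff.sum fun j _ => hcd j, fun x => ?_,
    fun x y hxy => ?_⟩
  · have hfl : ⌊f x⌋₊ ≤ N := Nat.floor_le_of_le (hfN x)
    have hl : (⌊f x⌋₊ : ℝ) ≤ ∑ j ∈ Finset.Icc 1 N, h j x := by
      rw [← hsum _ hfl]
      refine Finset.sum_le_sum fun j _ => ?_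
      split_ifs with hj
      · rw [hone j x ((Nat.le_floor_iff (hf0 x)).1 hj)]
      · exact h0 j x
    have hu : ∑ j ∈ Finset.Icc 1 N, h j x ≤ (⌊f x⌋₊ : ℝ) + 1 := by
      calc ∑ j ∈ Finset.Icc 1 N, h j x
          ≤ ∑ j ∈ Finset.Icc 1 N, if j ≤ ⌊f x⌋₊ + 1 then (1 : ℝ) else 0 := by
            refine Finset.sum_le_sum fun j _ => ?_
            split_ifs with hj
            · exact h1 j x
            · refine (hzero j x ?_).le
              have := Nat.lt_floor_add_one (f x)
              have : (⌊f x⌋₊ : ℝ) + 2 ≤ j := by exact_mod_cast (show ⌊f x⌋₊ + 2 ≤ j by omega)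
              linarith
        _ = ((Finset.Icc 1 N).filter fun j => j ≤ ⌊f x⌋₊ + 1).card := by simp
        _ ≤ (Finset.Icc 1 (⌊f x⌋₊ + 1)).card := by
            refine Nat.cast_le.2 (Finset.card_le_card fun j => ?_)
            simp only [Finset.mem_filter, Finset.mem_Icc]; omega
        _ = (⌊f x⌋₊ : ℝ) + 1 := by simp
    have h2 := Nat.floor_le (hf0 x)
    have h3 := Nat.lt_floor_add_one (f x)
    rw [abs_le]
    constructor <;> linarith
  · have hxy' := abs_le.1 (hf x y hxy)
    rw [← Finset.sum_sub_distrib]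
    calc |∑ j ∈ Finset.Icc 1 N, (h j x - h j y)|
        ≤ ∑ j ∈ Finset.Icc 1 N, |h j x - h j y| := Finset.abs_sum_le_sum_abs _ _
      _ ≤ ∑ j ∈ Finset.Icc 1 N,
          if j ∈ Finset.Icc ⌊f x⌋₊ (⌊f x⌋₊ + 2) then C * ‖x - y‖ else 0 := by
          refine Finset.sum_le_sum fun j _ => ?_
          split_ifs with hj
          · exact hlip j x y
          · rw [Finset.mem_Icc, not_and_or, not_le, not_le] at hj
            rcases hj with hj | hj
            · have h2 := Nat.floor_le (hf0 x)
              have h3 : (j : ℝ) + 1 ≤ ⌊f x⌋₊ := by exact_mod_cast hj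
              rw [hone j x (show (j : ℝ) ≤ f x by linarith),
                hone j y (show (j : ℝ) ≤ f y by linarith)]
              simp
            · have h2 := Nat.lt_floor_add_one (f x)
              have h3 : (⌊f x⌋₊ : ℝ) + 3 ≤ j := by exact_mod_cast hj
              rw [hzero j x (by linarith), hzero j y (by linarith)]
              simp
      _ = ((Finset.Icc 1 N).filter
            fun j => j ∈ Finset.Icc ⌊f x⌋₊ (⌊f x⌋₊ + 2)).card * (C * ‖x - y‖) := by
          rw [← Finset.sum_filter, Finset.sum_const, nsmul_eq_mul]
      _ ≤ (Finset.Icc ⌊f x⌋₊ (⌊f x⌋₊ + 2)).card * (C * ‖x - y‖) := by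
          gcongr
          intro j hj
          exact (Finset.mem_filter.1 hj).2
      _ = 3 * C * ‖x - y‖ := by
          rw [Nat.card_Icc, show ⌊f x⌋₊ + 2 + 1 - ⌊f x⌋₊ = 3 by omega]
          push_cast
          ring

/-- Scaled version of `IsCutoff.exists_approx`. -/
theorem IsCutoff.exists_approx_scaled [TopologicalSpace.SeparableSpace X] {k : ℕ∞} {a K : ℝ}
    {φ : X → ℝ} (hφ : IsCutoff k a K φ) :
    ∃ C : ℝ, 0 ≤ C ∧ ∀ (η δ B : ℝ) (f : X → ℝ), 0 < η → 0 < δ → (∀ x, 0 ≤ f x) →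
      (∀ x, f x ≤ B) → (∀ x y, ‖x - y‖ ≤ δ → |f x - f y| ≤ η) →
      ∃ g : X → ℝ, ContDiff ℝ k g ∧ (∀ x, |f x - g x| ≤ η) ∧
        ∀ x y, ‖x - y‖ ≤ δ → |g x - g y| ≤ C * (η * ‖x - y‖ / δ) := by
  obtain ⟨C, hC, H⟩ := hφ.exists_approx
  refine ⟨C, hC, fun η δ B f hη hδ hf0 hfB hf => ?_⟩
  obtain ⟨g, hg, hfg, hlip⟩ := H ⌈B / η⌉₊ (fun x => f (δ • x) / η)
    (fun x => div_nonneg (hf0 _) hη.le)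
    (fun x => (div_le_div_of_nonneg_right (hfB _) hη.le).trans (Nat.le_ceil _))
    (fun x y hxy => by
      rw [← sub_div, abs_div, abs_of_pos hη, div_le_one hη]
      refine hf _ _ ?_
      rw [← smul_sub, norm_smul, Real.norm_eq_abs, abs_of_pos hδ]
      exact mul_le_of_le_one_right hδ.le hxy)
  have hnorm : ∀ x y : X, ‖δ⁻¹ • x - δ⁻¹ • y‖ = ‖x - y‖ / δ := fun x y => by
    rw [← smul_sub, norm_smul, Real.norm_eq_abs, abs_of_pos (inv_pos.2 hδ), inv_mul_eq_div]
  refine ⟨fun x => η * g (δ⁻¹ • x), contDiff_const.mul (hg.comp (by fun_prop)), fun x => ?_,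
    fun x y hxy => ?_⟩
  · have h := hfg (δ⁻¹ • x)
    simp only [smul_inv_smul₀ hδ.ne'] at h
    calc |f x - η * g (δ⁻¹ • x)| = η * |f x / η - g (δ⁻¹ • x)| := by
          rw [← abs_of_pos hη, ← abs_mul, abs_of_pos hη]; congr 1; field_simp
      _ ≤ η := mul_le_of_le_one_right hη.le h
  · have h := hlip (δ⁻¹ • x) (δ⁻¹ • y) (by rw [hnorm]; exact (div_le_one hδ).2 hxy)
    rw [hnorm] at h
    calc |η * g (δ⁻¹ • x) - η * g (δ⁻¹ • y)| = η * |g (δ⁻¹ • x) - g (δ⁻¹ • y)| := by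
          rw [← mul_sub, abs_mul, abs_of_pos hη]
      _ ≤ η * (C * (‖x - y‖ / δ)) := by gcongr
      _ = C * (η * ‖x - y‖ / δ) := by ring

end Cutoff

end Smoothing

/-- The largest minorant `σ` of `ω` such that `σ t / t` is non-increasing. -/
noncomputable def subModulus (ω : ℝ → ℝ) (t : ℝ) : ℝ :=
  t * sInf ((fun s => ω s / s) '' Ioc 0 t)

namespace Admissible

variable {ω : ℝ → ℝ} (hω : Admissible ω)
include hω

theorem subModulus_nonneg {t : ℝ} (ht : 0 ≤ t) : 0 ≤ subModulus ω t := by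
  refine mul_nonneg ht (Real.sInf_nonneg ?_)
  rintro _ ⟨s, hs, rfl⟩
  exact div_nonneg (hω.1 s hs.1).le hs.1.le

theorem subModulus_le {s t : ℝ} (hs : 0 < s) (hst : s ≤ t) :
    subModulus ω t ≤ t * (ω s / s) := by
  refine mul_le_mul_of_nonneg_left (csInf_le ⟨0, ?_⟩ ⟨s, ⟨hs, hst⟩, rfl⟩) (hs.le.trans hst)
  rintro _ ⟨s, hs, rfl⟩
  exact div_nonneg (hω.1 s hs.1).le hs.1.le

theorem subModulus_le_self {t : ℝ} (ht : 0 < t) : subModulus ω t ≤ ω t := by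
  have := hω.subModulus_le ht le_rfl
  rwa [mul_div_cancel₀ _ ht.ne'] at this

omit hω in
theorem le_subModulus {t c : ℝ} (ht : 0 < t) (h : ∀ s, 0 < s → s ≤ t → c ≤ t * (ω s / s)) :
    c ≤ subModulus ω t := by
  rw [subModulus, mul_comm, ← div_le_iff₀ ht]
  refine le_csInf ⟨_, t, ⟨ht, le_rfl⟩, rfl⟩ ?_
  rintro _ ⟨s, hs, rfl⟩
  rw [div_le_iff₀ ht, mul_comm]
  exact h s hs.1 hs.2

theorem subModulus_mono {s t : ℝ} (hs : 0 < s) (hst : s ≤ t) :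
    subModulus ω s ≤ subModulus ω t := by
  refine le_subModulus (hs.trans_le hst) fun r hr hrt => ?_
  have hωr := hω.1 r hr
  rcases le_total r s with h | h
  · exact (hω.subModulus_le hr h).trans (by gcongr)
  · calc subModulus ω s ≤ ω s := hω.subModulus_le_self hs
      _ ≤ ω r := hω.2.1 s r hs h
      _ = r * (ω r / r) := by field_simp
      _ ≤ t * (ω r / r) := by gcongr

theorem mul_subModulus_le {s t : ℝ} (hs : 0 < s) (hst : s ≤ t) :
    s * subModulus ω t ≤ t * subModulus ω s := by
  have ht := hs.trans_le hst
  have : s * subModulus ω t / t ≤ subModulus ω s := by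
    refine le_subModulus hs fun r hr hrs => ?_
    rw [div_le_iff₀ ht]
    calc s * subModulus ω t ≤ s * (t * (ω r / r)) := by
          gcongr; exact hω.subModulus_le hr (hrs.trans hst)
      _ = s * (ω r / r) * t := by ring
  rw [div_le_iff₀ ht] at this
  linarith

theorem subModulus_le_mul {t T c : ℝ} (ht : 0 < t) (hc : 1 ≤ c) (hT : T ≤ c * t) (hT0 : 0 < T) :
    subModulus ω T ≤ c * subModulus ω t := by
  have h0 := hω.subModulus_nonneg ht.le
  rcases le_total T t with h | h
  · exact (hω.subModulus_mono hT0 h).trans (by nlinarith)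
  · have h1 := hω.mul_subModulus_le ht h
    have : t * subModulus ω T ≤ t * (c * subModulus ω t) := by nlinarith
    exact le_of_mul_le_mul_left this ht

theorem mul_subModulus_le_of_le {t T α κ : ℝ} (ht : 0 < t) (hT : 0 < T) (hα : 0 ≤ α)
    (hα1 : α ≤ 1) (hκ : 1 ≤ κ) (h : α ≤ κ * t / T) :
    α * subModulus ω T ≤ κ * subModulus ω t := by
  have h0 := hω.subModulus_nonneg ht.le
  have h0' := hω.subModulus_nonneg hT.le
  rcases le_total T t with hTt | hTt
  · have := hω.subModulus_mono hT hTt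
    nlinarith
  · have h1 := hω.mul_subModulus_le ht hTt
    calc α * subModulus ω T ≤ κ * t / T * subModulus ω T := by gcongr
      _ = κ * (t * subModulus ω T) / T := by ring
      _ ≤ κ * (T * subModulus ω t) / T := by gcongr
      _ = κ * subModulus ω t := by field_simp

theorem exists_le_subModulus (M : ℝ) : ∃ T : ℝ, 0 < T ∧ ∀ t, T ≤ t → M ≤ subModulus ω t := by
  obtain ⟨hpos, hmono, -, htop, hzero, -⟩ := id hω
  obtain ⟨a, ha, hsm⟩ : ∃ a : ℝ, 0 < a ∧ ∀ s, 0 < s → s ≤ a → s ≤ ω s := by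
    have h1 : ∀ᶠ s in nhdsWithin (0 : ℝ) (Ioi 0), s / ω s < 1 := hzero.eventually (gt_mem_nhds one_pos)
    obtain ⟨a, ha, has⟩ := mem_nhdsGT_iff_exists_Ioc_subset.1 h1
    exact ⟨a, ha, fun s hs hsa => ((div_lt_one (hpos s hs)).1 (has ⟨hs, hsa⟩)).le⟩
  obtain ⟨T₁, hT₁⟩ := eventually_atTop.1 (htop.eventually_ge_atTop |M|)
  set T₂ := max T₁ 1
  have hT₂ : 0 < T₂ := lt_max_of_lt_right one_pos
  have hωa := hpos a ha
  refine ⟨max T₂ (max |M| (|M| * T₂ / ω a)), lt_max_of_lt_left hT₂, fun t ht => ?_⟩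
  obtain ⟨h1, h23⟩ := max_le_iff.1 ht
  obtain ⟨h2, h3⟩ := max_le_iff.1 h23
  have ht0 := hT₂.trans_le h1
  rw [div_le_iff₀ hωa] at h3
  refine (le_abs_self M).trans (le_subModulus ht0 fun s hs hst => ?_)
  rw [mul_div_assoc', le_div_iff₀ hs]
  have hωs := hpos s hs
  rcases le_total s a with hsa | hsa
  · exact mul_le_mul h2 (hsm s hs hsa) hs.le ht0.le
  · rcases le_total T₂ s with hTs | hTs
    · rw [mul_comm]
      exact mul_le_mul hst (hT₁ s ((le_max_left _ _).trans hTs)) (abs_nonneg _) ht0.le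
    · calc |M| * s ≤ |M| * T₂ := by gcongr
        _ ≤ t * ω a := h3
        _ ≤ t * ω s := by gcongr; exact hmono a s ha hsa

theorem subModulus_pos {t : ℝ} (ht : 0 < t) : 0 < subModulus ω t := by
  obtain ⟨T, hT, h⟩ := hω.exists_le_subModulus 1
  have h1 := h (max T t) (le_max_left _ _)
  have h2 := hω.mul_subModulus_le ht (le_max_right T t)
  have h3 : 0 < max T t := lt_max_of_lt_left hT
  exact pos_of_mul_pos_right (lt_of_lt_of_le (by positivity) h2) h3.le

end Admissible

section Approximation

variable {X : Type*} [NormedAddCommGroup X] [NormedSpace ℝ X]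

/-- Subdividing a segment improves a bound by `ω` to a bound by `subModulus ω`. -/
theorem Admissible.abs_sub_le_of_segment {ω : ℝ → ℝ} (hω : Admissible ω) {f : X → ℝ} {u v : X}
    {c : ℝ} (hc : 0 ≤ c) (huv : u ≠ v)
    (h : ∀ p ∈ segment ℝ u v, ∀ q ∈ segment ℝ u v, p ≠ q → |f p - f q| ≤ c * ω ‖p - q‖) :
    |f u - f v| ≤ 2 * c * subModulus ω ‖u - v‖ := by
  rcases hc.eq_or_lt with rfl | hc
  · simpa using h u (left_mem_segment ℝ u v) v (right_mem_segment ℝ u v) huv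
  have ht : 0 < ‖u - v‖ := norm_pos_iff.2 (sub_ne_zero.2 huv)
  set t := ‖u - v‖
  rw [← div_le_iff₀' (by positivity)]
  refine Admissible.le_subModulus ht fun s hs hst => ?_
  rw [div_le_iff₀ (by positivity)]
  set n := ⌈t / s⌉₊
  have hts : 1 ≤ t / s := (one_le_div hs).2 hst
  have hn1 : t / s ≤ n := Nat.le_ceil _
  have hn0 : (0 : ℝ) < n := by linarith
  have hn2 : (n : ℝ) ≤ 2 * (t / s) := by
    have := Nat.ceil_lt_add_one (show 0 ≤ t / s by linarith)
    linarith
  have htn : t / n ≤ s := by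
    rw [div_le_iff₀ hs] at hn1
    rw [div_le_iff₀ hn0]
    linarith
  have hstep : ∀ i : ℕ, i ≤ n →
      |f u - f (AffineMap.lineMap u v ((i : ℝ) / n))| ≤ i * (c * ω (t / n)) := by
    intro i
    induction i with
    | zero => simp
    | succ i ih =>
      intro hi
      have hmem : ∀ j : ℕ, j ≤ n → AffineMap.lineMap u v ((j : ℝ) / n) ∈ segment ℝ u v := by
        intro j hj
        rw [segment_eq_image_lineMap]
        exact ⟨_, ⟨by positivity, (div_le_one hn0).2 (by exact_mod_cast hj)⟩, rfl⟩
      set p := AffineMap.lineMap u v ((i : ℝ) / n)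
      set q := AffineMap.lineMap u v (((i + 1 : ℕ) : ℝ) / n)
      have hpq : ‖p - q‖ = t / n := by
        rw [← dist_eq_norm, dist_lineMap_lineMap, dist_eq_norm u v, Real.dist_eq, ← sub_div,
          abs_div, abs_of_pos hn0]
        push_cast
        rw [sub_add_cancel_left, abs_neg, abs_one, one_div_mul_eq_div]
      have hne : p ≠ q := by
        rw [← sub_ne_zero, ← norm_pos_iff, hpq]
        positivity
      have h1 := h p (hmem i (by omega)) q (hmem (i + 1) hi) hne
      rw [hpq] at h1
      have h2 := ih (by omega)
      have h3 := abs_sub_le (f u) (f p) (f q)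
      push_cast
      linarith
  have hfin := hstep n le_rfl
  rw [div_self hn0.ne', AffineMap.lineMap_apply_one] at hfin
  have hωs := hω.1 s hs
  calc |f u - f v| ≤ n * (c * ω (t / n)) := hfin
    _ ≤ n * (c * ω s) := by gcongr; exact hω.2.1 _ _ (by positivity) htn
    _ ≤ 2 * (t / s) * (c * ω s) := by gcongr
    _ = t * (ω s / s) * (2 * c) := by ring

theorem VCfar.exists_growth {ω : ℝ → ℝ} (hω : Admissible ω) {f : X → ℝ} (hf : VCfar ω f) {ε : ℝ}
    (hε : 0 < ε) :
    ∃ ρ : ℝ, 0 < ρ ∧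
      (∀ x y, x ≠ y → (∀ p ∈ segment ℝ x y, ρ < ‖p‖) → |f x - f y| ≤ ε * subModulus ω ‖x - y‖) ∧
      ∀ x R, ρ ≤ R → |f x - f 0| ≤ ε * subModulus ω (max ‖x‖ R) := by
  obtain ⟨⟨M, hM⟩, hfar⟩ := hf
  obtain ⟨δ, hδ, hfar⟩ := hfar (ε / 4) (by positivity)
  have hM' : ∀ x y, x ≠ y → |f x - f y| ≤ 2 * |M| * subModulus ω ‖x - y‖ := fun x y hxy =>
    hω.abs_sub_le_of_segment (abs_nonneg M) hxy fun p _ q _ hpq =>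
      (hM p q hpq).trans (mul_le_mul_of_nonneg_right (le_abs_self M)
        (hω.1 _ (norm_pos_iff.2 (sub_ne_zero.2 hpq))).le)
  have hfar' : ∀ x y, x ≠ y → (∀ p ∈ segment ℝ x y, δ < ‖p‖) →
      |f x - f y| ≤ ε / 2 * subModulus ω ‖x - y‖ := fun x y hxy hseg => by
    have := hω.abs_sub_le_of_segment (f := f) (c := ε / 4) (by positivity) hxy
      fun p hp q hq hpq => hfar p q hpq (hseg p hp) (hseg q hq)
    rwa [show 2 * (ε / 4) = ε / 2 by ring] at this
  obtain ⟨T, hT, hTσ⟩ := hω.exists_le_subModulus (4 * |M| * subModulus ω (2 * δ) / ε)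
  have hnear : ∀ x R, T ≤ R → ‖x‖ ≤ 2 * δ → |f x - f 0| ≤ ε / 2 * subModulus ω R := by
    intro x R hR hx
    have h1 := hTσ R hR
    rw [div_le_iff₀ hε] at h1
    rcases eq_or_ne x 0 with rfl | hx0
    · have := hω.subModulus_nonneg (hT.le.trans hR)
      simp only [sub_self, abs_zero]; positivity
    · have h2 := hM' x 0 hx0
      rw [sub_zero] at h2
      have h3 : |M| * subModulus ω ‖x‖ ≤ |M| * subModulus ω (2 * δ) :=
        mul_le_mul_of_nonneg_left (hω.subModulus_mono (norm_pos_iff.2 hx0) hx) (abs_nonneg M)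
      linarith
  refine ⟨max T δ, lt_max_of_lt_left hT, fun x y hxy hseg => ?_, fun x R hR => ?_⟩
  · refine (hfar' x y hxy fun p hp => (le_max_right _ _).trans_lt (hseg p hp)).trans ?_
    have := hω.subModulus_nonneg (norm_nonneg (x - y))
    gcongr
    linarith
  · have hTR : T ≤ max ‖x‖ R := ((le_max_left _ _).trans hR).trans (le_max_right _ _)
    have hpos := hω.subModulus_nonneg (hT.le.trans hTR)
    rcases le_or_gt ‖x‖ (2 * δ) with hx | hx
    · exact (hnear x _ hTR hx).trans (by gcongr; linarith)
    · have hx0 : 0 < ‖x‖ := by linarith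
      set x₀ : X := (2 * δ / ‖x‖) • x with hx₀
      have hnorm : ‖x₀‖ = 2 * δ := by
        rw [hx₀, norm_smul, Real.norm_eq_abs, abs_of_pos (by positivity),
          div_mul_cancel₀ _ hx0.ne']
      have hne : x ≠ x₀ := fun h => by rw [← h] at hnorm; linarith
      have hdiff : ‖x - x₀‖ ≤ ‖x‖ := by
        have : x - x₀ = (1 - 2 * δ / ‖x‖) • x := by rw [sub_smul, one_smul]
        have h1 : 2 * δ / ‖x‖ < 1 := (div_lt_one hx0).2 hx
        have h2 : 0 < 2 * δ / ‖x‖ := by positivity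
        rw [this, norm_smul, Real.norm_eq_abs, abs_of_pos (by linarith)]
        exact mul_le_of_le_one_left hx0.le (by linarith)
      have h1 := hfar' x x₀ hne fun p hp => by
        obtain ⟨α, β, hα, hβ, hαβ, rfl⟩ := hp
        have : α • x + β • x₀ = (α + β * (2 * δ / ‖x‖)) • x := by
          rw [hx₀, smul_smul, add_smul]
        rw [this, norm_smul, Real.norm_eq_abs, abs_of_nonneg (by positivity), add_mul, mul_assoc,
          div_mul_cancel₀ _ hx0.ne']
        nlinarith
      have h2 := hω.subModulus_mono (norm_pos_iff.2 (sub_ne_zero.2 hne))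
        (hdiff.trans (le_max_left ‖x‖ R))
      have h3 := hnear x₀ _ hTR hnorm.le
      have h4 := abs_sub_le (f x) (f x₀) (f 0)
      nlinarith

theorem norm_sub_norm_sub_le_of_mem_segment {x y p : X} (hp : p ∈ segment ℝ x y) :
    ‖x‖ - ‖x - y‖ ≤ ‖p‖ := by
  obtain ⟨α, β, hα, hβ, hαβ, rfl⟩ := hp
  have h1 : x - (α • x + β • y) = β • (x - y) := by
    rw [← eq_sub_iff_add_eq] at hαβ
    subst hαβ
    module
  have h2 : ‖x - (α • x + β • y)‖ ≤ ‖x - y‖ := by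
    rw [h1, norm_smul, Real.norm_eq_abs, abs_of_nonneg hβ]
    exact mul_le_of_le_one_left (norm_nonneg _) (by linarith)
  have h3 := norm_sub_norm_le x (α • x + β • y)
  linarith

omit [NormedSpace ℝ X] in
/-- Cutting off a function of small growth costs little in the seminorm. -/
theorem Admissible.abs_mul_one_sub_cutoff_le {ω : ℝ → ℝ} (hω : Admissible ω) {F χ : X → ℝ}
    {ε R b κ : ℝ} (hε : 0 ≤ ε) (hR : 0 < R) (hb : 1 ≤ b) (hκ : 0 ≤ κ)
    (hF : ∀ x, |F x| ≤ ε * subModulus ω (max ‖x‖ R))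
    (hFlip : ∀ x y, x ≠ y → R < ‖x‖ → ‖x - y‖ < ‖x‖ / 2 →
      |F x - F y| ≤ ε * subModulus ω ‖x - y‖)
    (hχ0 : ∀ x, 0 ≤ χ x) (hχ1 : ∀ x, χ x ≤ 1) (hχone : ∀ x, ‖x‖ ≤ R → χ x = 1)
    (hχzero : ∀ x, b * R ≤ ‖x‖ → χ x = 0) (hχlip : ∀ x y, |χ x - χ y| ≤ κ * ‖x - y‖ / R)
    {x y : X} (hxy : x ≠ y) :
    |F x * (1 - χ x) - F y * (1 - χ y)| ≤ (5 + b * κ) * ε * subModulus ω ‖x - y‖ := by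
  wlog hyx : ‖y‖ ≤ ‖x‖ generalizing x y
  · rw [abs_sub_comm, norm_sub_rev]
    exact this hxy.symm (not_le.1 hyx).le
  have ht : 0 < ‖x - y‖ := norm_pos_iff.2 (sub_ne_zero.2 hxy)
  have hσ := hω.subModulus_nonneg ht.le
  rcases le_or_gt ‖x‖ R with hxR | hxR
  · rw [hχone x hxR, hχone y (hyx.trans hxR)]
    simp only [sub_self, mul_zero, abs_zero]
    positivity
  have h1 : |F x - F y| ≤ 4 * ε * subModulus ω ‖x - y‖ := by
    rcases lt_or_ge ‖x - y‖ (‖x‖ / 2) with h | h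
    · refine (hFlip x y hxy hxR h).trans ?_
      gcongr
      linarith
    · have hx := hF x
      have hy := hF y
      rw [max_eq_left hxR.le] at hx
      have h2 : subModulus ω (max ‖y‖ R) ≤ subModulus ω ‖x‖ :=
        hω.subModulus_mono (lt_max_of_lt_right hR) (max_le hyx hxR.le)
      have h3 : subModulus ω ‖x‖ ≤ 2 * subModulus ω ‖x - y‖ :=
        hω.subModulus_le_mul ht (by norm_num) (by linarith) (hR.trans hxR)
      have h4 := abs_sub (F x) (F y)
      have h5 := mul_le_mul_of_nonneg_left h2 hε
      have h6 := mul_le_mul_of_nonneg_left h3 hε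
      linarith
  have h2 : |F y| * |(1 - χ x) - (1 - χ y)| ≤ (1 + b * κ) * ε * subModulus ω ‖x - y‖ := by
    rw [sub_sub_sub_cancel_left, abs_sub_comm]
    rcases le_or_gt (b * R) ‖y‖ with h | h
    · rw [hχzero y h, hχzero x (h.trans hyx)]
      simp only [sub_self, abs_zero, mul_zero]
      positivity
    · have hbR : 0 < b * R := by positivity
      have hα1 : |χ x - χ y| ≤ 1 :=
        abs_le.2 ⟨by linarith [hχ0 x, hχ1 y], by linarith [hχ1 x, hχ0 y]⟩
      have h3 : |χ x - χ y| * subModulus ω (b * R) ≤ (1 + b * κ) * subModulus ω ‖x - y‖ := by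
        refine hω.mul_subModulus_le_of_le ht hbR (abs_nonneg _) hα1
          (by have : 0 ≤ b * κ := by positivity
              linarith) ((hχlip x y).trans ?_)
        rw [div_le_div_iff₀ hR hbR]
        have : 0 ≤ ‖x - y‖ * R := by positivity
        nlinarith
      have h4 : |F y| ≤ ε * subModulus ω (b * R) := by
        refine (hF y).trans ?_
        gcongr
        exact hω.subModulus_mono (lt_max_of_lt_right hR) (max_le h.le (by nlinarith))
      calc |F y| * |χ x - χ y| ≤ ε * subModulus ω (b * R) * |χ x - χ y| := by gcongr
        _ = ε * (|χ x - χ y| * subModulus ω (b * R)) := by ring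
        _ ≤ ε * ((1 + b * κ) * subModulus ω ‖x - y‖) := by gcongr
        _ = (1 + b * κ) * ε * subModulus ω ‖x - y‖ := by ring
  have h3 := abs_mul_sub_mul_le (p := F x) (q := F y) (r := 1 - χ x) (s := 1 - χ y)
    (by linarith [hχ1 x]) (by linarith [hχ0 x])
  linarith

omit [NormedSpace ℝ X] in
/-- Cutting off a uniformly small function which is regular at a small scale. -/
theorem Admissible.abs_mul_cutoff_le {ω : ℝ → ℝ} (hω : Admissible ω) {d χ : X → ℝ}
    {ε R C δ κ : ℝ} (hε : 0 ≤ ε) (hδ : 0 < δ) (hδR : δ ≤ R) (hκ : 0 ≤ κ) (hC : 0 ≤ C)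
    (hd : ∀ x, |d x| ≤ ε * subModulus ω δ)
    (hdlip : ∀ x y, x ≠ y → ‖x - y‖ ≤ δ →
      |d x - d y| ≤ ε * subModulus ω ‖x - y‖ + C * (ε * subModulus ω δ * ‖x - y‖ / δ))
    (hχ0 : ∀ x, 0 ≤ χ x) (hχ1 : ∀ x, χ x ≤ 1) (hχlip : ∀ x y, |χ x - χ y| ≤ κ * ‖x - y‖ / R)
    {x y : X} (hxy : x ≠ y) :
    |d x * χ x - d y * χ y| ≤ (3 + C + κ) * ε * subModulus ω ‖x - y‖ := by
  have ht : 0 < ‖x - y‖ := norm_pos_iff.2 (sub_ne_zero.2 hxy)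
  have hσ := hω.subModulus_nonneg ht.le
  have hR : 0 < R := hδ.trans_le hδR
  have h1 : |d x - d y| ≤ (2 + C) * ε * subModulus ω ‖x - y‖ := by
    rcases le_total ‖x - y‖ δ with h | h
    · have h2 := hω.mul_subModulus_le ht h
      have h3 : ε * subModulus ω δ * ‖x - y‖ / δ ≤ ε * subModulus ω ‖x - y‖ := by
        rw [div_le_iff₀ hδ]
        calc ε * subModulus ω δ * ‖x - y‖ = ε * (‖x - y‖ * subModulus ω δ) := by ring
          _ ≤ ε * (δ * subModulus ω ‖x - y‖) := by gcongr
          _ = ε * subModulus ω ‖x - y‖ * δ := by ring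
      have h4 := mul_le_mul_of_nonneg_left h3 hC
      have h5 : 0 ≤ ε * subModulus ω ‖x - y‖ := by positivity
      linarith [hdlip x y hxy h]
    · have h2 := mul_le_mul_of_nonneg_left (hω.subModulus_mono hδ h) hε
      have h3 : 0 ≤ C * (ε * subModulus ω ‖x - y‖) := by positivity
      linarith [abs_sub (d x) (d y), hd x, hd y]
  have h2 : |d y| * |χ x - χ y| ≤ (1 + κ) * ε * subModulus ω ‖x - y‖ := by
    have hα1 : |χ x - χ y| ≤ 1 :=
      abs_le.2 ⟨by linarith [hχ0 x, hχ1 y], by linarith [hχ1 x, hχ0 y]⟩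
    have h3 : |χ x - χ y| * subModulus ω δ ≤ (1 + κ) * subModulus ω ‖x - y‖ := by
      refine hω.mul_subModulus_le_of_le ht hδ (abs_nonneg _) hα1 (by linarith)
        ((hχlip x y).trans ?_)
      gcongr
      linarith
    calc |d y| * |χ x - χ y| ≤ ε * subModulus ω δ * |χ x - χ y| := by gcongr; exact hd y
      _ = ε * (|χ x - χ y| * subModulus ω δ) := by ring
      _ ≤ ε * ((1 + κ) * subModulus ω ‖x - y‖) := by gcongr
      _ = (1 + κ) * ε * subModulus ω ‖x - y‖ := by ring
  have h3 := abs_mul_sub_mul_le (p := d x) (q := d y) (r := χ x) (s := χ y) (hχ0 x) (hχ1 x)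
  linarith

theorem VCfull.exists_holderLE_sub [TopologicalSpace.SeparableSpace X] {k : ℕ∞} {a K : ℝ}
    {φ : X → ℝ} (hφ : IsCutoff k a K φ) {ω : ℝ → ℝ} (hω : Admissible ω) {f : X → ℝ}
    (hf : VCfull ω f) {ε : ℝ} (hε : 0 < ε) :
    ∃ g : X → ℝ, ContDiff ℝ k g ∧ (∃ L, LipschitzWith L g) ∧ BddSupp g ∧
      HolderLE ω (fun x => f x - g x) ε := by
  obtain ⟨⟨-, hsmall⟩, -, hfar⟩ := hf
  obtain ⟨C, hC, happrox⟩ := hφ.exists_approx_scaled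
  have ha := hφ.pos
  have hK := hφ.lip_nonneg
  set κ : ℝ := K * a
  set b : ℝ := 1 / (2 * a)
  have hκ : 0 ≤ κ := by positivity
  have hb : 1 ≤ b := by
    rw [le_div_iff₀ (by positivity)]
    linarith [hφ.le_half]
  set D : ℝ := (5 + b * κ) + (3 + C + κ)
  have hD : 0 < D := by positivity
  set η : ℝ := ε / D
  have hη : 0 < η := by positivity
  obtain ⟨ρ, hρ, hgrow_seg, hgrow⟩ := hfar.exists_growth hω hη
  obtain ⟨δ₀, hδ₀, hsmall⟩ := hsmall (η / 2) (by positivity)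
  have hosc : ∀ x y, x ≠ y → ‖x - y‖ < δ₀ → |f x - f y| ≤ η * subModulus ω ‖x - y‖ := by
    intro x y hxy hlt
    have := hω.abs_sub_le_of_segment (f := f) (c := η / 2) (by positivity) hxy
      fun p hp q hq hpq => hsmall p q hpq (lt_of_le_of_lt ?_ hlt)
    · rwa [show 2 * (η / 2) = η by ring] at this
    · rw [← dist_eq_norm, ← dist_eq_norm]
      refine (Metric.dist_le_diam_of_mem ?_ hp hq).trans ?_
      · rw [← convexHull_pair]; exact isBounded_convexHull.2 (by simp)
      · rw [← convexHull_pair, convexHull_diam, Metric.diam_pair]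
  set δ : ℝ := δ₀ / 2
  have hδ : 0 < δ := by positivity
  set R : ℝ := max (2 * ρ) δ
  have hδR : δ ≤ R := le_max_right _ _
  have hR : 0 < R := hδ.trans_le hδR
  have hρR : 2 * ρ ≤ R := le_max_left _ _
  set χ : X → ℝ := fun x => φ ((a / R) • x) with hχ
  have hnorm : ∀ x : X, ‖(a / R) • x‖ = a / R * ‖x‖ := fun x => by
    rw [norm_smul, Real.norm_eq_abs, abs_of_pos (by positivity)]
  have hχ0 : ∀ x, 0 ≤ χ x := fun x => hφ.nonneg _
  have hχ1 : ∀ x, χ x ≤ 1 := fun x => hφ.le_one _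
  have hχone : ∀ x, ‖x‖ ≤ R → χ x = 1 := fun x hx => hφ.eq_one _ (by
    rw [hnorm, div_mul_eq_mul_div, div_le_iff₀ hR]; gcongr)
  have hχzero : ∀ x, b * R ≤ ‖x‖ → χ x = 0 := fun x hx => hφ.eq_zero _ (by
    rw [hnorm, div_mul_eq_mul_div, le_div_iff₀ hR]
    rw [div_mul_eq_mul_div, div_le_iff₀ (by positivity)] at hx
    linarith)
  have hχlip : ∀ x y, |χ x - χ y| ≤ κ * ‖x - y‖ / R := fun x y => by
    refine (hφ.lip _ _).trans_eq ?_
    rw [← smul_sub, hnorm]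
    ring
  set F : X → ℝ := fun x => f x - f 0 with hFdef
  set B : ℝ := η * subModulus ω (b * R)
  have hbR : R ≤ b * R := le_mul_of_one_le_left hR.le hb
  have hB : 0 ≤ B := mul_nonneg hη.le (hω.subModulus_nonneg (hR.le.trans hbR))
  have hFgrow : ∀ x, |F x| ≤ η * subModulus ω (max ‖x‖ R) := fun x => hgrow x R (by linarith)
  have hFB : ∀ x, ‖x‖ ≤ b * R → |F x| ≤ B := fun x hx => (hFgrow x).trans
    (mul_le_mul_of_nonneg_left (hω.subModulus_mono (lt_max_of_lt_right hR) (max_le hx hbR)) hη.le)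
  set F₁ : X → ℝ := fun x => max (min (F x) B) (-B) + B with hF₁
  have hF₁lip : ∀ x y, |F₁ x - F₁ y| ≤ |f x - f y| := fun x y => by
    simp only [hF₁, add_sub_add_right_eq_sub]
    refine (abs_max_sub_max_le_abs _ _ _).trans ((abs_inf_sub_inf_le_abs _ _ _).trans_eq ?_)
    simp [hFdef]
  have hF₁eq : ∀ x, ‖x‖ ≤ b * R → F₁ x = F x + B := fun x hx => by
    obtain ⟨h1, h2⟩ := abs_le.1 (hFB x hx)
    simp only [hF₁]
    rw [min_eq_left h2, max_eq_left h1]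
  have hF₁0 : ∀ x, 0 ≤ F₁ x := fun x => by
    linarith [le_max_right (min (F x) B) (-B), show F₁ x = max (min (F x) B) (-B) + B from rfl]
  have hF₁B : ∀ x, F₁ x ≤ 2 * B := fun x => by
    have : max (min (F x) B) (-B) ≤ B := max_le (min_le_right _ _) (by linarith)
    linarith [show F₁ x = max (min (F x) B) (-B) + B from rfl]
  have hσδ := hω.subModulus_pos hδ
  obtain ⟨g, hg, hgF, hglip⟩ := happrox (η * subModulus ω δ) δ (2 * B) F₁ (by positivity) hδ
    hF₁0 hF₁B fun x y hxy => by
      rcases eq_or_ne x y with rfl | hne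
      · simp only [sub_self, abs_zero]; positivity
      · refine (hF₁lip x y).trans ((hosc x y hne (hxy.trans_lt (by simp only [δ]; linarith))).trans ?_)
        have := hω.subModulus_mono (norm_pos_iff.2 (sub_ne_zero.2 hne)) hxy
        gcongr
  refine ⟨fun x => (g x - B) * χ x, (hg.sub contDiff_const).mul (hφ.contDiff.comp (by fun_prop)),
    ?_, ⟨b * R, fun x hx => by simp [hχzero x hx.le]⟩, fun x y hxy => ?_⟩
  · set E : ℝ := B + η * subModulus ω δ
    have hE : 0 ≤ E := by positivity
    have hgE : ∀ x, |g x - B| ≤ E := fun x => by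
      have h1 := abs_le.1 (hgF x)
      have h2 := hF₁0 x
      have h3 := hF₁B x
      rw [abs_le]
      simp only [E]
      constructor <;> linarith
    have hgχ : ∀ x, |(g x - B) * χ x| ≤ E := fun x => by
      rw [abs_mul, abs_of_nonneg (hχ0 x)]
      exact (mul_le_of_le_one_right (abs_nonneg _) (hχ1 x)).trans (hgE x)
    set L₁ : ℝ := C * (η * subModulus ω δ / δ) + E * (κ / R)
    have hL₁ : 0 ≤ L₁ := by positivity
    refine ⟨_, LipschitzWith.of_dist_le' (K := L₁ + 2 * E / δ) fun x y => ?_⟩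
    rw [Real.dist_eq, dist_eq_norm, add_mul]
    rcases le_total ‖x - y‖ δ with h | h
    · have h1 := abs_mul_sub_mul_le (p := g x - B) (q := g y - B) (s := χ y) (hχ0 x) (hχ1 x)
      rw [sub_sub_sub_cancel_right] at h1
      calc _ ≤ _ := h1
        _ ≤ C * (η * subModulus ω δ * ‖x - y‖ / δ) + E * (κ * ‖x - y‖ / R) := by
          gcongr
          exacts [hglip x y h, hgE y, hχlip x y]
        _ = L₁ * ‖x - y‖ := by simp only [L₁]; ring
        _ ≤ _ := le_add_of_nonneg_right (by positivity)
    · have h1 : 2 * E ≤ 2 * E / δ * ‖x - y‖ := by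
        rw [div_mul_eq_mul_div, le_div_iff₀ hδ]
        gcongr
      have h2 : 0 ≤ L₁ * ‖x - y‖ := by positivity
      linarith [abs_sub ((g x - B) * χ x) ((g y - B) * χ y), hgχ x, hgχ y]
  · have ht : 0 < ‖x - y‖ := norm_pos_iff.2 (sub_ne_zero.2 hxy)
    have hsplit : ∀ x, f x - (g x - B) * χ x = f 0 + F x * (1 - χ x) + (F₁ x - g x) * χ x := by
      intro x
      rcases le_total ‖x‖ (b * R) with h | h
      · rw [hF₁eq x h]; simp only [hFdef]; ring
      · rw [hχzero x h]; simp only [hFdef]; ring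
    have h1 := hω.abs_mul_one_sub_cutoff_le hη.le hR hb hκ hFgrow (fun x y hxy hx hlt => by
      have := hgrow_seg x y hxy fun p hp => by
        have := norm_sub_norm_sub_le_of_mem_segment hp
        linarith
      simpa [hFdef] using this) hχ0 hχ1 hχone hχzero hχlip hxy
    have h2 := hω.abs_mul_cutoff_le (d := fun x => F₁ x - g x) hη.le hδ hδR hκ hC hgF
      (fun x y hxy hle => by
        rw [sub_sub_sub_comm]
        refine (abs_sub _ _).trans (add_le_add ((hF₁lip x y).trans
          (hosc x y hxy (hle.trans_lt ?_))) (hglip x y hle))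
        simp only [δ]; linarith) hχ0 hχ1 hχlip hxy
    have hDη : D * η = ε := mul_div_cancel₀ _ hD.ne'
    have hσω := hω.subModulus_le_self ht
    rw [Real.norm_eq_abs]
    simp only [hsplit]
    calc _ = |(F x * (1 - χ x) - F y * (1 - χ y)) +
          ((F₁ x - g x) * χ x - (F₁ y - g y) * χ y)| := by ring_nf
      _ ≤ (5 + b * κ) * η * subModulus ω ‖x - y‖ + (3 + C + κ) * η * subModulus ω ‖x - y‖ :=
          (abs_add_le _ _).trans (add_le_add h1 h2)
      _ = D * η * subModulus ω ‖x - y‖ := by simp only [D]; ring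
      _ = ε * subModulus ω ‖x - y‖ := by rw [hDη]
      _ ≤ ε * ω ‖x - y‖ := by gcongr

omit [NormedSpace ℝ X] in
/-- A boundedly supported Lipschitz function is vanishing at small and large scales and far away. -/
theorem BddSupp.exists_vanishing {ω : ℝ → ℝ} (hω : Admissible ω) {g : X → ℝ} {L : NNReal}
    (hL : LipschitzWith L g) (hg : BddSupp g) {ε : ℝ} (hε : 0 < ε) :
    ∃ δ : ℝ, 0 < δ ∧ (∀ x y, x ≠ y → ‖x - y‖ < δ → |g x - g y| ≤ ε * ω ‖x - y‖) ∧
      ∃ T : ℝ, 0 < T ∧ (∀ x y, T < ‖x - y‖ → |g x - g y| ≤ ε * ω ‖x - y‖) ∧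
        ∀ x y, x ≠ y → T < ‖x‖ → T < ‖y‖ → |g x - g y| ≤ ε * ω ‖x - y‖ := by
  obtain ⟨R, hR⟩ := hg
  obtain ⟨hpos, -, -, htop, hzero, -⟩ := hω
  have hlip : ∀ x y, |g x - g y| ≤ L * ‖x - y‖ := fun x y => by
    simpa [Real.dist_eq, dist_eq_norm] using hL.dist_le_mul x y
  have hbdd : ∀ x, |g x| ≤ |g 0| + L * |R| := fun x => by
    rcases lt_or_ge R ‖x‖ with h | h
    · rw [hR x h, abs_zero]; positivity
    · have h1 := hlip x 0
      rw [sub_zero] at h1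
      have h2 : (L : ℝ) * ‖x‖ ≤ L * |R| := by gcongr; exact h.trans (le_abs_self R)
      linarith [abs_sub_abs_le_abs_sub (g x) (g 0)]
  have h1 : ∀ᶠ t in nhdsWithin (0 : ℝ) (Ioi 0), t / ω t < ε / (L + 1) :=
    hzero.eventually (gt_mem_nhds (by positivity))
  obtain ⟨δ, hδ, hδs⟩ := mem_nhdsGT_iff_exists_Ioc_subset.1 h1
  obtain ⟨T, hT⟩ := eventually_atTop.1 (htop.eventually_ge_atTop (2 * (|g 0| + L * |R|) / ε))
  refine ⟨δ, hδ, fun x y hxy hlt => ?_, max 1 (max T R), lt_max_of_lt_left one_pos,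
    fun x y hlt => ?_, fun x y hxy hx hy => ?_⟩
  · have ht : 0 < ‖x - y‖ := norm_pos_iff.2 (sub_ne_zero.2 hxy)
    have h2 : ‖x - y‖ / ω ‖x - y‖ < ε / (L + 1) := hδs ⟨ht, hlt.le⟩
    rw [div_lt_div_iff₀ (hpos _ ht) (by positivity)] at h2
    linarith [hlip x y]
  · have h2 := hT ‖x - y‖ (((le_max_left T R).trans (le_max_right 1 _)).trans hlt.le)
    rw [div_le_iff₀ hε] at h2
    linarith [abs_sub (g x) (g y), hbdd x, hbdd y]
  · have hRT : R ≤ max 1 (max T R) := (le_max_right T R).trans (le_max_right 1 _)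
    have := hpos _ (norm_pos_iff.2 (sub_ne_zero.2 hxy))
    rw [hR x (hRT.trans_lt hx), hR y (hRT.trans_lt hy), sub_self, abs_zero]
    positivity

omit [NormedSpace ℝ X] in
theorem vcfull_of_forall_exists_holderLE {ω : ℝ → ℝ} (hω : Admissible ω) {f : X → ℝ}
    (hf : HolderFinite ω f)
    (h : ∀ ε : ℝ, 0 < ε → ∃ g : X → ℝ, (∃ L, LipschitzWith L g) ∧ BddSupp g ∧
      HolderLE ω (fun x => f x - g x) ε) : VCfull ω f := by
  have key : ∀ ε : ℝ, 0 < ε →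
      ∃ δ : ℝ, 0 < δ ∧ (∀ x y, x ≠ y → ‖x - y‖ < δ → ‖f x - f y‖ ≤ ε * ω ‖x - y‖) ∧
      ∃ T : ℝ, 0 < T ∧ (∀ x y, T < ‖x - y‖ → ‖f x - f y‖ ≤ ε * ω ‖x - y‖) ∧
        ∀ x y, x ≠ y → T < ‖x‖ → T < ‖y‖ → ‖f x - f y‖ ≤ ε * ω ‖x - y‖ := by
    intro ε hε
    obtain ⟨g, ⟨L, hL⟩, hg, hfg⟩ := h (ε / 2) (by positivity)
    obtain ⟨δ, hδ, hs, T, hT, hl, hfr⟩ := hg.exists_vanishing hω hL (half_pos hε)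
    have hadd : ∀ x y, x ≠ y → |g x - g y| ≤ ε / 2 * ω ‖x - y‖ →
        ‖f x - f y‖ ≤ ε * ω ‖x - y‖ := by
      intro x y hxy hgxy
      have h1 := hfg x y hxy
      rw [Real.norm_eq_abs] at h1 ⊢
      calc |f x - f y| = |(f x - g x - (f y - g y)) + (g x - g y)| := by ring_nf
        _ ≤ ε / 2 * ω ‖x - y‖ + ε / 2 * ω ‖x - y‖ :=
          (abs_add_le _ _).trans (add_le_add h1 hgxy)
        _ = ε * ω ‖x - y‖ := by ring
    refine ⟨δ, hδ, fun x y hxy hlt => hadd x y hxy (hs x y hxy hlt), T, hT,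
      fun x y hlt => hadd x y ?_ (hl x y hlt), fun x y hxy hx hy => hadd x y hxy (hfr x y hxy hx hy)⟩
    rintro rfl
    rw [sub_self, norm_zero] at hlt
    exact lt_asymm hT hlt
  refine ⟨⟨hf, fun ε hε => ?_⟩, ⟨hf, fun ε hε => ?_⟩, hf, fun ε hε => ?_⟩
  · obtain ⟨δ, hδ, hs, -⟩ := key ε hε
    exact ⟨δ, hδ, hs⟩
  · obtain ⟨-, -, -, T, hT, hl, -⟩ := key ε hε
    exact ⟨T, hT, hl⟩
  · obtain ⟨-, -, -, T, hT, -, hfr⟩ := key ε hε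
    exact ⟨T, hT, hfr⟩

end Approximation

/-- Theorem 1.3 (ii): in a separable normed space with a `C^k` Lipschitz bump, the closure of
the boundedly supported `C^k` Lipschitz functions in the `Ċ^{0,ω}` seminorm equals `VC^{0,ω}`. -/
theorem closure_Ck_lip_bs_eq_vc
    {X : Type*} [NormedAddCommGroup X] [NormedSpace ℝ X]
    [TopologicalSpace.SeparableSpace X]
    (k : ℕ∞)
    (hbump : ∃ φ : X → ℝ, φ ≠ 0 ∧ ContDiff ℝ k φ ∧ (∃ L, LipschitzWith L φ) ∧ BddSupp φ)
    (ω : ℝ → ℝ) (hω : Admissible ω) (f : X → ℝ) :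
    VCfull ω f ↔
      (HolderFinite ω f ∧ ∀ ε : ℝ, 0 < ε → ∃ g : X → ℝ,
        ContDiff ℝ k g ∧ (∃ L, LipschitzWith L g) ∧ BddSupp g ∧
        HolderLE ω (fun x => f x - g x) ε) := by
  obtain ⟨a, K, φ, hφ⟩ := exists_isCutoff hbump
  refine ⟨fun hf => ⟨hf.1.1, fun ε hε => hf.exists_holderLE_sub hφ hω hε⟩, fun ⟨hf, h⟩ =>
    vcfull_of_forall_exists_holderLE hω hf fun ε hε => ?_⟩
  obtain ⟨g, -, hL, hg, hfg⟩ := h ε hε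
  exact ⟨g, hL, hg, hfg⟩
end

section
/- Let α ∈ (0,1] and let X be a Banach space whose norm has modulus of smoothness of power type 1+α, i.e. there is C > 0 with ‖x+h‖^{1+α} + ‖x−h‖^{1+α} − 2‖x‖^{1+α} ≤ C‖h‖^{1+α} for all x, h ∈ X. Let ω be an admissible modulus. Then the closure, in the Ċ^{0,ω}(X,ℝ) seminorm, of the set of real-valued functions on X that are simultaneously of class C^{1,α}, Lipschitz, and in Ċ^{0,ω}(X,ℝ), equals VC^{0,ω}_small(X,ℝ). -/
open Filter Set

/-- `f : X → ℝ` is of class `C^{1,α}`: Fréchet differentiable everywhere with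
`α`-Hölder derivative `Df : X → X*`. -/
def C1Alpha {X : Type*} [NormedAddCommGroup X] [NormedSpace ℝ X]
    (α : ℝ) (f : X → ℝ) : Prop :=
  Differentiable ℝ f ∧ ∃ M : ℝ, ∀ x y : X,
    ‖fderiv ℝ f x - fderiv ℝ f y‖ ≤ M * ‖x - y‖ ^ α

section Regularization

variable {X : Type*} [NormedAddCommGroup X]

/-- The infimal convolution of `f` with the kernel `φ`. -/
noncomputable def infConv (φ f : X → ℝ) (x : X) : ℝ := ⨅ y, (f y + φ (x - y))

section InfConv

variable {φ f : X → ℝ} {η : ℝ}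

theorem infConv_le (H : ∀ x y, f x ≤ f y + φ (x - y) + η) (x y : X) :
    infConv φ f x ≤ f y + φ (x - y) := by
  refine ciInf_le ⟨f x - η, ?_⟩ y
  rintro _ ⟨z, rfl⟩
  have := H x z
  simp only
  linarith

theorem sub_le_infConv (H : ∀ x y, f x ≤ f y + φ (x - y) + η) (x : X) :
    f x - η ≤ infConv φ f x :=
  le_ciInf fun y => by linarith [H x y]

theorem infConv_le_self (H : ∀ x y, f x ≤ f y + φ (x - y) + η) (hφ : φ 0 = 0) (x : X) :
    infConv φ f x ≤ f x := by
  simpa [hφ] using infConv_le H x x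

theorem infConv_add_le (H : ∀ x y, f x ≤ f y + φ (x - y) + η) {h : X} {m : ℝ}
    (hm : ∀ a, f (a + h) ≤ f a + m) (x : X) :
    infConv φ f (x + h) ≤ infConv φ f x + m := by
  suffices infConv φ f (x + h) - m ≤ infConv φ f x by linarith
  refine le_ciInf fun y => ?_
  have h1 := infConv_le H (x + h) (y + h)
  rw [add_sub_add_right_eq_sub] at h1
  linarith [hm y]

/-- An infimal convolution inherits the translation bounds of its kernel. -/
theorem infConv_add_le_of_kernel (H : ∀ x y, f x ≤ f y + φ (x - y) + η) {h : X} {m : ℝ}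
    (hm : ∀ a, φ (a + h) ≤ φ a + m) (x : X) :
    infConv φ f (x + h) ≤ infConv φ f x + m := by
  suffices infConv φ f (x + h) - m ≤ infConv φ f x by linarith
  refine le_ciInf fun y => ?_
  have h1 := infConv_le H (x + h) y
  rw [add_sub_right_comm] at h1
  linarith [hm (x - y)]

/-- An infimal convolution inherits the semiconcavity of its kernel. -/
theorem infConv_semiconcave (H : ∀ x y, f x ≤ f y + φ (x - y) + η) {h : X} {c : ℝ}
    (hc : ∀ a, φ (a + h) + φ (a - h) ≤ 2 * φ a + c) (x : X) :
    infConv φ f (x + h) + infConv φ f (x - h) ≤ 2 * infConv φ f x + c := by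
  suffices (infConv φ f (x + h) + infConv φ f (x - h) - c) / 2 ≤ infConv φ f x by linarith
  refine le_ciInf fun y => ?_
  have h1 := infConv_le H (x + h) y
  have h2 := infConv_le H (x - h) y
  rw [add_sub_right_comm] at h1
  rw [sub_right_comm] at h2
  linarith [hc (x - y)]

end InfConv

/-- `w` is semiconvex with defect `k`. -/
def Semiconvex (k w : X → ℝ) : Prop :=
  ∀ x h, 2 * w x ≤ w (x + h) + w (x - h) + k h

/-- The largest function below `u` that is semiconvex with defect `k`. -/
noncomputable def semiconvexEnvelope (k u : X → ℝ) (x : X) : ℝ :=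
  ⨆ w : {w : X → ℝ // Semiconvex k w ∧ ∀ x, w x ≤ u x}, w.1 x

section Envelope

variable {k u w : X → ℝ}

theorem le_semiconvexEnvelope (hw : Semiconvex k w) (hwu : ∀ x, w x ≤ u x) (x : X) :
    w x ≤ semiconvexEnvelope k u x := by
  refine le_ciSup (f := fun w : {w : X → ℝ // Semiconvex k w ∧ ∀ x, w x ≤ u x} => w.1 x)
    ⟨u x, ?_⟩ ⟨w, hw, hwu⟩
  rintro _ ⟨v, rfl⟩
  exact v.2.2 x

theorem semiconvexEnvelope_le (hw : Semiconvex k w) (hwu : ∀ x, w x ≤ u x) (x : X) :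
    semiconvexEnvelope k u x ≤ u x :=
  have : Nonempty {w : X → ℝ // Semiconvex k w ∧ ∀ x, w x ≤ u x} := ⟨⟨w, hw, hwu⟩⟩
  ciSup_le fun v => v.2.2 x

theorem semiconvex_semiconvexEnvelope (hw : Semiconvex k w) (hwu : ∀ x, w x ≤ u x) :
    Semiconvex k (semiconvexEnvelope k u) := by
  intro x h
  have : Nonempty {w : X → ℝ // Semiconvex k w ∧ ∀ x, w x ≤ u x} := ⟨⟨w, hw, hwu⟩⟩
  suffices semiconvexEnvelope k u x ≤
      (semiconvexEnvelope k u (x + h) + semiconvexEnvelope k u (x - h) + k h) / 2 by linarith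
  refine ciSup_le fun v => ?_
  have h1 := le_semiconvexEnvelope v.2.1 v.2.2 (x + h)
  have h2 := le_semiconvexEnvelope v.2.1 v.2.2 (x - h)
  linarith [v.2.1 x h]

theorem semiconvexEnvelope_add_le (hw : Semiconvex k w) (hwu : ∀ x, w x ≤ u x) {h : X} {m : ℝ}
    (hm : ∀ a, u (a + h) ≤ u a + m) (x : X) :
    semiconvexEnvelope k u (x + h) ≤ semiconvexEnvelope k u x + m := by
  have hS := semiconvex_semiconvexEnvelope hw hwu
  suffices semiconvexEnvelope k u (x + h) - m ≤ semiconvexEnvelope k u x by linarith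
  refine le_semiconvexEnvelope (w := fun a => semiconvexEnvelope k u (a + h) - m)
    (fun a l => ?_) (fun a => ?_) x
  · have := hS (a + h) l
    rw [add_right_comm a h l, add_sub_right_comm] at this
    simp only
    linarith
  · linarith [hm a, semiconvexEnvelope_le hw hwu (a + h)]

/-- The semiconvex envelope of a semiconcave function is semiconcave. -/
theorem semiconvexEnvelope_semiconcave (hw : Semiconvex k w) (hwu : ∀ x, w x ≤ u x) {h : X} {c : ℝ}
    (hc : ∀ a, u (a + h) + u (a - h) ≤ 2 * u a + c) (x : X) :
    semiconvexEnvelope k u (x + h) + semiconvexEnvelope k u (x - h) ≤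
      2 * semiconvexEnvelope k u x + c := by
  have hS := semiconvex_semiconvexEnvelope hw hwu
  suffices (semiconvexEnvelope k u (x + h) + semiconvexEnvelope k u (x - h) - c) / 2 ≤
      semiconvexEnvelope k u x by linarith
  refine le_semiconvexEnvelope
    (w := fun a => (semiconvexEnvelope k u (a + h) + semiconvexEnvelope k u (a - h) - c) / 2)
    (fun a l => ?_) (fun a => ?_) x
  · have h1 := hS (a + h) l
    have h2 := hS (a - h) l
    rw [add_right_comm a h l, add_sub_right_comm] at h1
    rw [sub_add_eq_add_sub, sub_right_comm] at h2
    simp only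
    linarith
  · linarith [hc a, semiconvexEnvelope_le hw hwu (a + h), semiconvexEnvelope_le hw hwu (a - h)]

end Envelope

end Regularization

section SecondDifference

variable {X : Type*} [NormedAddCommGroup X] [NormedSpace ℝ X]

theorem abs_parallelogram_le {g : X → ℝ} {k : ℝ → ℝ}
    (hg : ∀ x h, |g (x + h) + g (x - h) - 2 * g x| ≤ k ‖h‖)
    (hk : MonotoneOn k (Ici 0)) {d : ℝ} {x h l : X} (hh : ‖h‖ ≤ d) (hl : ‖l‖ ≤ d) :
    |g (x + h + l) + g x - g (x + h) - g (x + l)| ≤ 2 * k d := by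
  have hd : 0 ≤ d := (norm_nonneg h).trans hh
  have hnorm : ∀ a : X, ‖a‖ ≤ 2 * d → k ‖(2⁻¹ : ℝ) • a‖ ≤ k d := fun a ha => by
    refine hk (norm_nonneg _) hd ?_
    rw [norm_smul, Real.norm_of_nonneg (by norm_num)]
    linarith
  have h1 := (hg (x + (2⁻¹ : ℝ) • (h + l)) ((2⁻¹ : ℝ) • (h + l))).trans
    (hnorm _ ((norm_add_le _ _).trans (by linarith)))
  have h2 := (hg (x + (2⁻¹ : ℝ) • (h + l)) ((2⁻¹ : ℝ) • (h - l))).trans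
    (hnorm _ ((norm_sub_le _ _).trans (by linarith)))
  rw [show x + (2⁻¹ : ℝ) • (h + l) + (2⁻¹ : ℝ) • (h + l) = x + h + l by module,
    show x + (2⁻¹ : ℝ) • (h + l) - (2⁻¹ : ℝ) • (h + l) = x by module] at h1
  rw [show x + (2⁻¹ : ℝ) • (h + l) + (2⁻¹ : ℝ) • (h - l) = x + h by module,
    show x + (2⁻¹ : ℝ) • (h + l) - (2⁻¹ : ℝ) • (h - l) = x + l by module] at h2
  rw [abs_le] at *
  constructor <;> linarith [h1.1, h1.2, h2.1, h2.2]

/-- A function whose second differences are `O(‖h‖ ^ (1 + α))` has dyadic difference quotients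
converging at rate `‖h‖ ^ (1 + α)`. -/
theorem exists_tendsto_dyadic_quotient {α K : ℝ} (hα : 0 < α) {g : X → ℝ}
    (hg : ∀ x h, |g (x + h) + g (x - h) - 2 * g x| ≤ K * ‖h‖ ^ (1 + α)) (x h : X) :
    ∃ l : ℝ, Tendsto (fun n : ℕ => (2 : ℝ) ^ n * (g (x + ((2 : ℝ)⁻¹ ^ n) • h) - g x)) atTop
      (nhds l) ∧
      |g (x + h) - g x - l| ≤ K / (1 - 2⁻¹ ^ α) * ‖h‖ ^ (1 + α) := by
  set D : ℕ → ℝ := fun n => (2 : ℝ) ^ n * (g (x + ((2 : ℝ)⁻¹ ^ n) • h) - g x) with hD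
  set r : ℝ := 2⁻¹ ^ α with hr
  have hr1 : r < 1 := Real.rpow_lt_one (by norm_num) (by norm_num) hα
  have hr0 : 0 < r := Real.rpow_pos_of_pos (by norm_num) _
  have hKh : 0 ≤ K * ‖h‖ ^ (1 + α) := (abs_nonneg _).trans (hg x h)
  have hstep : ∀ n, dist (D n) (D (n + 1)) ≤ K * ‖h‖ ^ (1 + α) * r ^ n := by
    intro n
    have h1 := hg (x + ((2 : ℝ)⁻¹ ^ (n + 1)) • h) (((2 : ℝ)⁻¹ ^ (n + 1)) • h)
    rw [add_assoc, ← add_smul, add_sub_cancel_right,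
      show (2 : ℝ)⁻¹ ^ (n + 1) + (2 : ℝ)⁻¹ ^ (n + 1) = (2 : ℝ)⁻¹ ^ n by ring] at h1
    have h2 : D n - D (n + 1) = (2 : ℝ) ^ n * (g (x + ((2 : ℝ)⁻¹ ^ n) • h) + g x -
        2 * g (x + ((2 : ℝ)⁻¹ ^ (n + 1)) • h)) := by
      simp only [hD]
      ring
    rw [Real.dist_eq, h2, abs_mul, abs_of_pos (by positivity)]
    have h3 : ‖((2 : ℝ)⁻¹ ^ (n + 1)) • h‖ ^ (1 + α) =
        2⁻¹ ^ (n + 1) * r ^ (n + 1) * ‖h‖ ^ (1 + α) := by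
      rw [norm_smul, Real.norm_of_nonneg (by positivity),
        Real.mul_rpow (by positivity) (norm_nonneg _), Real.rpow_add (by positivity),
        Real.rpow_one, hr, ← Real.rpow_natCast, ← Real.rpow_natCast (2⁻¹ ^ α),
        ← Real.rpow_mul (by norm_num), ← Real.rpow_mul (by norm_num), mul_comm α]
    rw [h3] at h1
    calc (2 : ℝ) ^ n * _ ≤ 2 ^ n * (K * (2⁻¹ ^ (n + 1) * r ^ (n + 1) * ‖h‖ ^ (1 + α))) := by gcongr
      _ = K * ‖h‖ ^ (1 + α) * r ^ n * (r / 2) * (2 ^ n * 2⁻¹ ^ n) := by ring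
      _ = K * ‖h‖ ^ (1 + α) * r ^ n * (r / 2) := by
        rw [← mul_pow, mul_inv_cancel₀ (by norm_num), one_pow, mul_one]
      _ ≤ K * ‖h‖ ^ (1 + α) * r ^ n := mul_le_of_le_one_right (by positivity) (by linarith)
  obtain ⟨l, hl⟩ := cauchySeq_tendsto_of_complete (cauchySeq_of_le_geometric r _ hr1 hstep)
  refine ⟨l, hl, ?_⟩
  have h0 := dist_le_of_le_geometric_of_tendsto₀ r _ hr1 hstep hl
  rw [Real.dist_eq] at h0
  simp only [hD, pow_zero, one_mul, one_smul] at h0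
  exact h0.trans_eq (by ring)

/-- A Lipschitz function whose second differences are `O(‖h‖ ^ (1 + α))` has a first order Taylor
expansion with remainder `O(‖h‖ ^ (1 + α))`. -/
theorem exists_taylor_of_second_difference {α K : ℝ} (hα : 0 < α) {g : X → ℝ}
    (hg : ∀ x h, |g (x + h) + g (x - h) - 2 * g x| ≤ K * ‖h‖ ^ (1 + α))
    {b : ℝ} (hb : ∀ x h, |g (x + h) - g x| ≤ b * ‖h‖) (x : X) :
    ∃ L : X →L[ℝ] ℝ, ∀ h,
      |g (x + h) - g x - L h| ≤ K / (1 - 2⁻¹ ^ α) * ‖h‖ ^ (1 + α) := by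
  choose L hL hLrem using exists_tendsto_dyadic_quotient hα hg x
  have hbound : ∀ h, ‖L h‖ ≤ b * ‖h‖ := by
    intro h
    refine le_of_tendsto (hL h).norm (Eventually.of_forall fun n => ?_)
    rw [norm_mul, Real.norm_of_nonneg (by positivity), Real.norm_eq_abs]
    calc (2 : ℝ) ^ n * _ ≤ 2 ^ n * (b * ‖((2 : ℝ)⁻¹ ^ n) • h‖) := by gcongr; exact hb _ _
      _ = b * ‖h‖ * (2 ^ n * 2⁻¹ ^ n) := by
        rw [norm_smul, Real.norm_of_nonneg (by positivity)]
        ring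
      _ = b * ‖h‖ := by rw [← mul_pow, mul_inv_cancel₀ (by norm_num), one_pow, mul_one]
  have hK : ∀ h : X, 0 ≤ K * ‖h‖ ^ (1 + α) := fun h => (abs_nonneg _).trans (hg x h)
  have hadd : ∀ h l, L (h + l) = L h + L l := by
    intro h l
    rcases subsingleton_or_nontrivial X with hX | hX
    · have h0 : ∀ a, L a = 0 := fun a => by
        have := hbound a
        rw [Subsingleton.elim a 0, norm_zero, mul_zero] at this
        rw [Subsingleton.elim a 0]
        exact norm_le_zero_iff.mp this
      simp [h0]
    have hK0 : 0 ≤ K := by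
      obtain ⟨v, hv⟩ := exists_ne (0 : X)
      exact nonneg_of_mul_nonneg_left (hK v) (Real.rpow_pos_of_pos (norm_pos_iff.mpr hv) _)
    set d := max ‖h‖ ‖l‖
    have hd : 0 ≤ d := (norm_nonneg h).trans (le_max_left _ _)
    have hmono : MonotoneOn (fun t : ℝ => K * t ^ (1 + α)) (Ici 0) := fun s hs t _ hst =>
      mul_le_mul_of_nonneg_left (Real.rpow_le_rpow hs hst (by linarith)) hK0
    have hlim : Tendsto (fun n : ℕ => 2 * K * d ^ (1 + α) * ((2 : ℝ)⁻¹ ^ α) ^ n) atTop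
        (nhds 0) := by
      have := tendsto_pow_atTop_nhds_zero_of_lt_one
        (Real.rpow_nonneg (by norm_num : (0 : ℝ) ≤ 2⁻¹) α)
        (Real.rpow_lt_one (by norm_num) (by norm_num) hα)
      simpa using this.const_mul (2 * K * d ^ (1 + α))
    have hdiff := ((hL (h + l)).sub (hL h)).sub (hL l)
    have hzero := tendsto_nhds_unique hdiff (squeeze_zero_norm (fun n => ?_) hlim)
    · linarith
    have hs : (0 : ℝ) ≤ 2⁻¹ ^ n := by positivity
    have hnorm : ∀ a : X, ‖a‖ ≤ d → ‖((2 : ℝ)⁻¹ ^ n) • a‖ ≤ 2⁻¹ ^ n * d := fun a ha => by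
      rw [norm_smul, Real.norm_of_nonneg hs]
      exact mul_le_mul_of_nonneg_left ha hs
    have h1 := abs_parallelogram_le (x := x) hg hmono (hnorm h (le_max_left _ _))
      (hnorm l (le_max_right _ _))
    rw [add_assoc, ← smul_add] at h1
    rw [← mul_sub, ← mul_sub, norm_mul, Real.norm_of_nonneg (by positivity), Real.norm_eq_abs]
    calc (2 : ℝ) ^ n * _ = 2 ^ n * |g (x + (2⁻¹ ^ n : ℝ) • (h + l)) + g x -
          g (x + (2⁻¹ ^ n : ℝ) • h) - g (x + (2⁻¹ ^ n : ℝ) • l)| := by congr 2; ring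
      _ ≤ 2 ^ n * (2 * (K * (2⁻¹ ^ n * d) ^ (1 + α))) := by gcongr
      _ = 2 * K * d ^ (1 + α) * (2⁻¹ ^ α) ^ n * (2 ^ n * 2⁻¹ ^ n) := by
        rw [Real.mul_rpow hs hd, Real.rpow_add (by positivity : (0 : ℝ) < 2⁻¹ ^ n), Real.rpow_one,
          Real.rpow_pow_comm (by norm_num)]
        ring
      _ = 2 * K * d ^ (1 + α) * (2⁻¹ ^ α) ^ n := by
        rw [← mul_pow, mul_inv_cancel₀ (by norm_num), one_pow, mul_one]
  let A : X →+ ℝ := AddMonoidHom.mk' L hadd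
  exact ⟨A.toRealLinearMap (AddMonoidHomClass.continuous_of_bound A b hbound), hLrem⟩

/-- A Lipschitz function whose second differences are `O(‖h‖ ^ (1 + α))` is of class `C^{1,α}`. -/
theorem c1Alpha_of_second_difference {α K : ℝ} (hα : 0 < α) (hK : 0 ≤ K) {g : X → ℝ}
    (hg : ∀ x h, |g (x + h) + g (x - h) - 2 * g x| ≤ K * ‖h‖ ^ (1 + α))
    {b : ℝ} (hb : ∀ x h, |g (x + h) - g x| ≤ b * ‖h‖) : C1Alpha α g := by
  choose L hL using exists_taylor_of_second_difference hα hg hb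
  set K' := K / (1 - 2⁻¹ ^ α)
  have hderiv : ∀ x, HasFDerivAt g (L x) x := by
    intro x
    rw [hasFDerivAt_iff_isLittleO_nhds_zero]
    refine (Asymptotics.IsBigO.of_bound K' (g := fun h : X => ‖h‖ ^ (1 + α))
      (Eventually.of_forall fun h => ?_)).trans_isLittleO ?_
    · rw [Real.norm_eq_abs, Real.norm_of_nonneg (Real.rpow_nonneg (norm_nonneg _) _)]
      exact hL x h
    · refine Asymptotics.isLittleO_norm_right.mp ?_
      have h1 : (fun h : X => ‖h‖ ^ (1 + α)) = fun h => ‖h‖ ^ α * ‖h‖ := by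
        ext h
        rw [add_comm, Real.rpow_add_one' (norm_nonneg _) (by linarith)]
      have h2 : Tendsto (fun h : X => ‖h‖ ^ α) (nhds 0) (nhds 0) := by
        have : Continuous fun h : X => ‖h‖ ^ α := continuous_norm.rpow_const fun _ => Or.inr hα.le
        simpa [Real.zero_rpow hα.ne'] using this.tendsto 0
      rw [h1]
      simpa using ((Asymptotics.isLittleO_one_iff ℝ).mpr h2).mul_isBigO
        (Asymptotics.isBigO_refl (fun h : X => ‖h‖) (nhds 0))
  have hmono : MonotoneOn (fun t : ℝ => K * t ^ (1 + α)) (Ici 0) := fun s hs t _ hst =>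
    mul_le_mul_of_nonneg_left (Real.rpow_le_rpow hs hst (by linarith)) hK
  refine ⟨fun x => (hderiv x).differentiableAt, 2 * K' + 2 * K, fun x y => ?_⟩
  have hr : (2⁻¹ : ℝ) ^ α < 1 := Real.rpow_lt_one (by norm_num) (by norm_num) hα
  have hK' : 0 ≤ K' := div_nonneg hK (by linarith)
  rw [(hderiv x).fderiv, (hderiv y).fderiv]
  rcases eq_or_ne x y with rfl | hxy
  · simp [Real.zero_rpow hα.ne']
  have hd : 0 < ‖x - y‖ := norm_sub_pos_iff.mpr hxy
  have hsphere : ∀ h : X, ‖h‖ = ‖x - y‖ →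
      ‖(L x - L y) h‖ ≤ (2 * K' + 2 * K) * ‖x - y‖ ^ α * ‖h‖ := by
    intro h hh
    have h1 := hL x h
    have h2 := hL y h
    have h3 := abs_parallelogram_le (x := y) (h := x - y) (l := h) hg hmono le_rfl hh.le
    rw [add_sub_cancel] at h3
    rw [hh] at h1 h2 ⊢
    rw [mul_assoc, ← Real.rpow_add_one' hd.le (by linarith), add_comm α,
      sub_apply, Real.norm_eq_abs]
    rw [abs_le] at *
    constructor <;> nlinarith [h1.1, h1.2, h2.1, h2.2, h3.1, h3.2]
  refine ContinuousLinearMap.opNorm_le_bound _ (by positivity) fun h => ?_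
  rcases eq_or_ne h 0 with rfl | hh
  · simp
  have hh' : 0 < ‖h‖ := norm_pos_iff.mpr hh
  have h1 := hsphere ((‖x - y‖ / ‖h‖) • h) (by
    rw [norm_smul, Real.norm_of_nonneg (by positivity), div_mul_cancel₀ _ hh'.ne'])
  rw [map_smul, norm_smul, norm_smul, mul_left_comm] at h1
  refine le_of_mul_le_mul_left h1 ?_
  rw [Real.norm_of_nonneg (by positivity)]
  positivity

end SecondDifference

section Approximation

variable {X : Type*} [NormedAddCommGroup X] [NormedSpace ℝ X]

/-- A uniformly continuous function is Lipschitz for large distances. -/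
theorem exists_le_add_mul_norm {f : X → ℝ} {η r : ℝ} (hη : 0 < η) (hr : 0 < r)
    (hf : ∀ x h, ‖h‖ < r → f (x + h) ≤ f x + η) :
    ∃ b, 0 < b ∧ ∀ x y, f x ≤ f y + b * ‖x - y‖ + η := by
  refine ⟨η / r, by positivity, fun x y => ?_⟩
  have hchain : ∀ (n : ℕ) (h : X), ‖h‖ < r → f (y + (n : ℝ) • h) ≤ f y + n * η := by
    intro n h hh
    induction n with
    | zero => simp
    | succ n ih =>
      have := hf (y + (n : ℝ) • h) h hh
      push_cast
      rw [add_smul, one_smul, ← add_assoc]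
      linarith
  set n : ℕ := ⌊‖x - y‖ / r⌋₊ + 1
  have hn : ‖x - y‖ / r < n := by
    simpa [n] using Nat.lt_floor_add_one (‖x - y‖ / r)
  have hn0 : (0 : ℝ) < n := by positivity
  have h1 := hchain n ((n : ℝ)⁻¹ • (x - y)) (by
    rw [norm_smul, norm_inv, Real.norm_natCast, inv_mul_lt_iff₀ hn0]
    exact (div_lt_iff₀ hr).mp hn)
  rw [smul_inv_smul₀ hn0.ne', add_sub_cancel] at h1
  have h2 : (n : ℝ) ≤ ‖x - y‖ / r + 1 := by
    simp only [n]
    push_cast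
    linarith [Nat.floor_le (div_nonneg (norm_nonneg (x - y)) hr.le)]
  calc f x ≤ f y + n * η := h1
    _ ≤ f y + (‖x - y‖ / r + 1) * η := by gcongr
    _ = f y + η / r * ‖x - y‖ + η := by ring

/-- In a space whose norm is smooth of power type `1 + α`, a Lipschitz function can be uniformly
approximated by `C^{1,α}` functions satisfying the same translation bounds. -/
theorem exists_c1Alpha_approx {α C : ℝ} (hα : 0 < α) (hC : 0 < C)
    (hsmooth : ∀ x h : X,
      ‖x + h‖ ^ (1 + α) + ‖x - h‖ ^ (1 + α) - 2 * ‖x‖ ^ (1 + α) ≤ C * ‖h‖ ^ (1 + α))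
    {f : X → ℝ} {b η : ℝ} (hb : 0 < b) (hη : 0 < η) (hf : ∀ x h, f (x + h) ≤ f x + b * ‖h‖) :
    ∃ g : X → ℝ, C1Alpha α g ∧ (∀ x, f x - 2 * η ≤ g x ∧ g x ≤ f x) ∧
      ∀ h m, (∀ a, f (a + h) ≤ f a + m) → ∀ x, g (x + h) ≤ g x + m := by
  obtain ⟨K, hK, hbK⟩ : ∃ K : ℝ, 0 < K ∧ ∀ t : ℝ, 0 ≤ t → b * t ≤ K * t ^ (1 + α) + η := by
    refine ⟨b / (η / b) ^ α, by positivity, fun t ht => ?_⟩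
    rcases le_total t (η / b) with h | h
    · have h1 : b * t ≤ η := by rwa [le_div_iff₀' hb] at h
      have : 0 ≤ b / (η / b) ^ α * t ^ (1 + α) := by positivity
      linarith
    · have h1 : (η / b) ^ α ≤ t ^ α := Real.rpow_le_rpow (by positivity) h hα.le
      have h2 : b * t ≤ b / (η / b) ^ α * t ^ (1 + α) := by
        rw [add_comm, Real.rpow_add_one' ht (by linarith), div_mul_eq_mul_div,
          le_div_iff₀ (by positivity)]
        calc b * t * (η / b) ^ α ≤ b * t * t ^ α := by gcongr
          _ = b * (t ^ α * t) := by ring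
      linarith
  set φ : X → ℝ := fun z => K * ‖z‖ ^ (1 + α) with hφ
  set k : X → ℝ := fun h => K * C * ‖h‖ ^ (1 + α) with hk
  have hφ0 : φ 0 = 0 := by simp [hφ, Real.zero_rpow (by linarith : 1 + α ≠ 0)]
  have hφk : ∀ h a, φ (a + h) + φ (a - h) ≤ 2 * φ a + k h := by
    intro h a
    have := mul_le_mul_of_nonneg_left (hsmooth a h) hK.le
    simp only [hφ, hk]
    linarith
  have H : ∀ x y, f x ≤ f y + φ (x - y) + η := by
    intro x y
    have h1 := hf y (x - y)
    rw [add_sub_cancel] at h1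
    have h2 := hbK ‖x - y‖ (norm_nonneg _)
    simp only [hφ]
    linarith
  have hbump : ∀ y, Semiconvex k fun x => f y - φ (x - y) - 2 * η := by
    intro y x h
    have h1 := hφk h (x - y)
    rw [← add_sub_right_comm, sub_right_comm] at h1
    simp only
    linarith
  have hφsymm : ∀ x y : X, φ (x - y) = φ (y - x) := fun x y => by simp only [hφ, norm_sub_rev]
  have hbumple : ∀ y x, f y - φ (x - y) - 2 * η ≤ infConv φ f x := by
    intro y x
    have h1 := H y x
    rw [hφsymm] at h1
    linarith [sub_le_infConv H x]
  have hw := hbump 0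
  have hwu := hbumple 0
  set g := semiconvexEnvelope k (infConv φ f) with hgdef
  have hlow : ∀ x, f x - 2 * η ≤ g x := by
    intro x
    simpa [hφ0] using le_semiconvexEnvelope (hbump x) (hbumple x) x
  have hup : ∀ x, g x ≤ f x := fun x =>
    (semiconvexEnvelope_le hw hwu x).trans (infConv_le_self H hφ0 x)
  have htrans : ∀ h m, (∀ a, f (a + h) ≤ f a + m) → ∀ x, g (x + h) ≤ g x + m := fun h m hm =>
    semiconvexEnvelope_add_le hw hwu (infConv_add_le H hm)
  refine ⟨g, ?_, fun x => ⟨hlow x, hup x⟩, htrans⟩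
  have hsecond : ∀ x h, |g (x + h) + g (x - h) - 2 * g x| ≤ K * C * ‖h‖ ^ (1 + α) := by
    intro x h
    have h1 := semiconvex_semiconvexEnvelope hw hwu x h
    have h2 := semiconvexEnvelope_semiconcave hw hwu (infConv_semiconcave H (hφk h)) x
    rw [abs_le]
    constructor <;> linarith
  refine c1Alpha_of_second_difference hα (by positivity) hsecond (b := b) fun x h => ?_
  have h1 := htrans h _ (fun a => hf a h) x
  have h2 := htrans (-h) _ (fun a => hf a (-h)) (x + h)
  rw [add_neg_cancel_right, norm_neg] at h2
  rw [abs_le]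
  constructor <;> linarith

end Approximation

/-- Theorem 1.4 (i): in a super-reflexive space admitting a renorming with modulus of smoothness
of power type `1+α`, the closure of `C^{1,α} ∩ Lip ∩ Ċ^{0,ω}` in the `Ċ^{0,ω}` seminorm equals
`VC^{0,ω}_small`. -/
theorem closure_C1alpha_lip_eq_vcsmall
    {X : Type*} [NormedAddCommGroup X] [NormedSpace ℝ X] [CompleteSpace X]
    (α C : ℝ) (hα : α ∈ Ioc (0:ℝ) 1) (hC : 0 < C)
    (hsmooth : ∀ x h : X,
      ‖x + h‖ ^ (1 + α) + ‖x - h‖ ^ (1 + α) - 2 * ‖x‖ ^ (1 + α) ≤ C * ‖h‖ ^ (1 + α))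
    (ω : ℝ → ℝ) (hω : Admissible ω) (f : X → ℝ) :
    VCsmall ω f ↔
      (HolderFinite ω f ∧ ∀ ε : ℝ, 0 < ε → ∃ g : X → ℝ,
        C1Alpha α g ∧ (∃ L, LipschitzWith L g) ∧ HolderFinite ω g ∧
        HolderLE ω (fun x => f x - g x) ε) := by
  obtain ⟨hpos, hmono, hzero, -, hlin, -⟩ := hω
  constructor
  · rintro ⟨⟨M, hM⟩, hsmall⟩
    refine ⟨⟨M, hM⟩, fun ε hε => ?_⟩
    obtain ⟨δ, hδ, hfδ⟩ := hsmall (ε / 2) (by positivity)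
    set η := ε * ω δ / 6 with hηdef
    have hη : 0 < η := by have := hpos δ hδ; positivity
    have hfδ' : ∀ h : X, h ≠ 0 → ‖h‖ < δ → ∀ a, f (a + h) ≤ f a + ε / 2 * ω ‖h‖ := by
      intro h h0 hh a
      have h1 := hfδ (a + h) a (by simpa using h0) (by simpa using hh)
      rw [add_sub_cancel_left, Real.norm_eq_abs] at h1
      linarith [le_abs_self (f (a + h) - f a)]
    obtain ⟨b, hb, hfb⟩ : ∃ b, 0 < b ∧ ∀ x y, f x ≤ f y + b * ‖x - y‖ + η := by
      have hev : ∀ᶠ t in nhdsWithin 0 (Ioi 0), ω t < η / (ε / 2) :=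
        hzero.eventually (gt_mem_nhds (by positivity))
      obtain ⟨r, hr, hrω⟩ := mem_nhdsGT_iff_exists_Ioo_subset.mp hev
      refine exists_le_add_mul_norm hη (lt_min hr hδ) fun x h hh => ?_
      rcases eq_or_ne h 0 with rfl | h0
      · simpa using hη.le
      have h1 : ω ‖h‖ < η / (ε / 2) :=
        hrω ⟨norm_pos_iff.mpr h0, hh.trans_le (min_le_left _ _)⟩
      have h2 := hfδ' h h0 (hh.trans_le (min_le_right _ _)) x
      rw [lt_div_iff₀' (by positivity)] at h1
      linarith
    have hφ : ∀ h a : X, b * ‖a + h‖ ≤ b * ‖a‖ + b * ‖h‖ := fun h a => by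
      rw [← mul_add]
      exact mul_le_mul_of_nonneg_left (norm_add_le _ _) hb.le
    set f₁ := infConv (fun z => b * ‖z‖) f
    obtain ⟨g, hgC, hgf, hgt⟩ := exists_c1Alpha_approx hα.1 hC hsmooth hb hη (f := f₁)
      fun x h => infConv_add_le_of_kernel (φ := fun z => b * ‖z‖) hfb (hφ h) x
    have hclose : ∀ x, 0 ≤ f x - g x ∧ f x - g x ≤ 3 * η := fun x => by
      have h1 := sub_le_infConv (φ := fun z => b * ‖z‖) hfb x
      have h2 := infConv_le_self (φ := fun z => b * ‖z‖) hfb (by simp) x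
      constructor <;> linarith [(hgf x).1, (hgf x).2]
    have hdiff : HolderLE ω (fun x => f x - g x) ε := by
      intro x y hxy
      have hd : 0 < ‖x - y‖ := norm_sub_pos_iff.mpr hxy
      rw [Real.norm_eq_abs, abs_le]
      rcases lt_or_ge ‖x - y‖ δ with h | h
      · have hside : ∀ x y : X, x ≠ y → ‖x - y‖ < δ →
            f x ≤ f y + ε / 2 * ω ‖x - y‖ ∧ g x ≤ g y + ε / 2 * ω ‖x - y‖ := by
          intro x y hxy h
          have h1 := hfδ' (x - y) (sub_ne_zero.mpr hxy) h
          have h2 := hgt _ _ (infConv_add_le (φ := fun z => b * ‖z‖) hfb h1) y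
          have h3 := h1 y
          rw [add_sub_cancel] at h2 h3
          exact ⟨h3, h2⟩
        have h1 := hside x y hxy h
        have h2 := hside y x hxy.symm (by rwa [norm_sub_rev])
        rw [norm_sub_rev y x] at h2
        constructor <;> linarith [h1.1, h1.2, h2.1, h2.2]
      · have h1 := mul_le_mul_of_nonneg_left (hmono δ _ hδ h) hε.le
        constructor <;> linarith [(hclose x).1, (hclose x).2, (hclose y).1, (hclose y).2]
    refine ⟨g, hgC, ⟨b.toNNReal, ?_⟩, ⟨M + ε, fun x y hxy => ?_⟩, hdiff⟩
    · refine LipschitzWith.of_le_add_mul _ fun x y => ?_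
      have h1 := hgt (x - y) _ (fun a => infConv_add_le_of_kernel (φ := fun z => b * ‖z‖) hfb (hφ (x - y)) a) y
      rwa [add_sub_cancel, ← dist_eq_norm, ← Real.coe_toNNReal b hb.le] at h1
    · have h1 := hM x y hxy
      have h2 := hdiff x y hxy
      calc ‖g x - g y‖ = ‖(f x - f y) - ((f x - g x) - (f y - g y))‖ := by congr 1; ring
        _ ≤ ‖f x - f y‖ + ‖(f x - g x) - (f y - g y)‖ := norm_sub_le _ _
        _ ≤ (M + ε) * ω ‖x - y‖ := by linarith
  · rintro ⟨hfin, happrox⟩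
    refine ⟨hfin, fun ε hε => ?_⟩
    obtain ⟨g, -, ⟨L, hL⟩, -, hfg⟩ := happrox (ε / 2) (by positivity)
    have hev : ∀ᶠ t in nhdsWithin 0 (Ioi 0), t / ω t < ε / 2 / (L + 1) :=
      hlin.eventually (gt_mem_nhds (by positivity))
    obtain ⟨r, hr, hrω⟩ := mem_nhdsGT_iff_exists_Ioo_subset.mp hev
    refine ⟨r, hr, fun x y hxy hxr => ?_⟩
    have hd : 0 < ‖x - y‖ := norm_sub_pos_iff.mpr hxy
    have h1 : ‖x - y‖ / ω ‖x - y‖ < ε / 2 / (L + 1) := hrω ⟨hd, hxr⟩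
    rw [div_lt_div_iff₀ (hpos _ hd) (by positivity)] at h1
    have h2 := hfg x y hxy
    have h3 := hL.norm_sub_le x y
    calc ‖f x - f y‖ = ‖((f x - g x) - (f y - g y)) + (g x - g y)‖ := by congr 1; ring
      _ ≤ ‖(f x - g x) - (f y - g y)‖ + ‖g x - g y‖ := norm_add_le _ _
      _ ≤ ε * ω ‖x - y‖ := by linarith
end
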